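/- arXiv:1908.11455 — 2 statements merged into one kernel-verified Lean document; each statement's English description precedes it below -/
import Mathlib

section
/- For every permutation w ∈ S_∞ with Coxeter length n, the Edelman–Greene statistic EG(w) = Σ_λ a_{w,λ} is at most the number of involutions in S_n. -/
open Equiv

/-- The simple transposition `sᵢ = (i, i+1)` in `S_∞` (realized as `Equiv.Perm ℕ`). -/
def EGs (i : ℕ) : Equiv.Perm ℕ := Equiv.swap i (i + 1)

/-- Coxeter length: the minimal length of a word in the simple transpositions for `w`. -/
noncomputable def coxLength (w : Equiv.Perm ℕ) : ℕ :=
  sInf {k | ∃ l : List ℕ, (l.map EGs).prod = w ∧ l.length = k}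

/-- `l` is a reduced word for `w`. -/
def IsReducedWord (w : Equiv.Perm ℕ) (l : List ℕ) : Prop :=
  (l.map EGs).prod = w ∧ l.length = coxLength w

/-- Top-to-bottom, right-to-left reading word of a filling of `μ`. -/
def readingWord (μ : YoungDiagram) (T : ℕ → ℕ → ℕ) : List ℕ :=
  (List.range (μ.colLen 0)).flatMap fun i =>
    ((List.range (μ.rowLen i)).reverse).map fun j => T i j

/-- Standard Young tableaux of shape `μ`, as entry functions: strictly increasing along
rows and columns, zero outside `μ`, and the labels on the cells are exactly `1,…,|μ|`. -/
def SYTset (μ : YoungDiagram) : Set (ℕ → ℕ → ℕ) :=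
  {T | (∀ i j1 j2, j1 < j2 → (i, j2) ∈ μ.cells → T i j1 < T i j2) ∧
       (∀ i1 i2 j, i1 < i2 → (i2, j) ∈ μ.cells → T i1 j < T i2 j) ∧
       (∀ i j, (i, j) ∉ μ.cells → T i j = 0) ∧
       μ.cells.image (fun c => T c.1 c.2) = Finset.Icc 1 μ.card}

/-- Edelman–Greene tableaux of type `(μ, w)`, as entry functions: strictly increasing
along rows and columns, zero outside `μ`, whose reading word is a reduced word of `w`. -/
def EGset (μ : YoungDiagram) (w : Equiv.Perm ℕ) : Set (ℕ → ℕ → ℕ) :=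
  {T | (∀ i j1 j2, j1 < j2 → (i, j2) ∈ μ.cells → T i j1 < T i j2) ∧
       (∀ i1 i2 j, i1 < i2 → (i2, j) ∈ μ.cells → T i1 j < T i2 j) ∧
       (∀ i j, (i, j) ∉ μ.cells → T i j = 0) ∧
       IsReducedWord w (readingWord μ T)}

/-- Standardization: the cell `(i,j)` receives the rank of its entry, where equal
entries are ordered left to right (by column). -/
def stdEntry (μ : YoungDiagram) (T : ℕ → ℕ → ℕ) (i j : ℕ) : ℕ :=
  if (i, j) ∈ μ.cells then
    (μ.cells.filter fun c =>
      T c.1 c.2 < T i j ∨ (T c.1 c.2 = T i j ∧ c.2 < j) ∨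
        (T c.1 c.2 = T i j ∧ c.2 = j ∧ c.1 ≤ i)).card
  else 0

/-- `k` is a descent of the standard tableau `U`: the cell labeled `k - 1` lies weakly
east of the cell labeled `k`. -/
def IsDescent (μ : YoungDiagram) (U : ℕ → ℕ → ℕ) (k : ℕ) : Prop :=
  ∃ c ∈ μ.cells, ∃ c' ∈ μ.cells, U c.1 c.2 = k ∧ U c'.1 c'.2 = k - 1 ∧ c.2 ≤ c'.2

open scoped Classical in
/-- The sweep map: a cell's entry is one plus the number of descents of `U` that are
at most its label in `U`. -/
noncomputable def sweepEntry (μ : YoungDiagram) (U : ℕ → ℕ → ℕ) (i j : ℕ) : ℕ :=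
  if (i, j) ∈ μ.cells then
    ((Finset.Icc 1 (U i j)).filter fun k => IsDescent μ U k).card + 1
  else 0

/-- `w` is totally commutative: it has a reduced word whose letters are pairwise
at distance at least `2`. -/
def TotallyCommutative (w : Equiv.Perm ℕ) : Prop :=
  ∃ l : List ℕ, IsReducedWord w l ∧ l.Pairwise fun a b => 2 ≤ Nat.dist a b


-- ===== words =====
theorem EGs_mul_self (k : ℕ) : EGs k * EGs k = 1 := Equiv.swap_mul_self _ _

theorem coxLength_le (l : List ℕ) : coxLength (l.map EGs).prod ≤ l.length :=
  Nat.sInf_le ⟨l, rfl, rfl⟩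

/-- Exchange property, in the form of deleting a letter. -/
theorem exchange (k : ℕ) (l : List ℕ) :
    ∀ u : Equiv.Perm ℕ, u⁻¹ k < u⁻¹ (k + 1) →
      (u * (l.map EGs).prod)⁻¹ (k + 1) < (u * (l.map EGs).prod)⁻¹ k →
      ∃ l1 m l2, l = l1 ++ m :: l2 ∧
        EGs k * (u * (l.map EGs).prod) = u * ((l1 ++ l2).map EGs).prod := by
  induction l with
  | nil => intro u h1 h2; simp only [List.map_nil, List.prod_nil, mul_one] at h2; omega
  | cons a l ih =>
    intro u h1 h2
    by_cases h : (u * EGs a)⁻¹ k < (u * EGs a)⁻¹ (k + 1)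
    · obtain ⟨l1, m, l2, e1, e2⟩ := ih (u * EGs a) h (by simpa [mul_assoc] using h2)
      refine ⟨a :: l1, m, l2, by simp [e1], ?_⟩
      simpa [mul_assoc] using e2
    · refine ⟨[], a, l, rfl, ?_⟩
      have hk : u⁻¹ k = a ∧ u⁻¹ (k + 1) = a + 1 := by
        simp only [mul_inv_rev, Equiv.Perm.mul_apply, EGs, Equiv.swap_inv,
          Equiv.swap_apply_def] at h
        have hne : u⁻¹ k ≠ u⁻¹ (k + 1) := fun h => by simp at h
        split_ifs at h <;> omega
      have : EGs k * u = u * EGs a := by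
        have h3 : k = u a := by rw [← hk.1]; simp
        have h4 : k + 1 = u (a + 1) := by rw [← hk.2]; simp
        have := Equiv.mul_swap_eq_swap_mul u a (a + 1)
        unfold EGs
        rw [this, ← h3, ← h4]
      simp only [List.nil_append, List.map_cons, List.prod_cons]
      rw [← mul_assoc, this, mul_assoc, ← mul_assoc (EGs a), EGs_mul_self, one_mul]

theorem exchange' (k : ℕ) (l : List ℕ)
    (h : (l.map EGs).prod⁻¹ (k + 1) < (l.map EGs).prod⁻¹ k) :
      ∃ l1 m l2, l = l1 ++ m :: l2 ∧
        EGs k * (l.map EGs).prod = ((l1 ++ l2).map EGs).prod := by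
  simpa using exchange k l 1 (by simp) (by simpa using h)

/-- The first letter of a reduced word is a left descent. -/
theorem descent_of_reduced (k : ℕ) (l : List ℕ)
    (h : coxLength ((k :: l).map EGs).prod = (k :: l).length) :
    ((k :: l).map EGs).prod⁻¹ (k + 1) < ((k :: l).map EGs).prod⁻¹ k := by
  by_contra hc
  have hd : (l.map EGs).prod⁻¹ (k + 1) < (l.map EGs).prod⁻¹ k := by
    have hne : (l.map EGs).prod⁻¹ (k + 1) ≠ (l.map EGs).prod⁻¹ k := fun h => by simp at h
    simp only [List.map_cons, List.prod_cons, mul_inv_rev, Equiv.Perm.mul_apply, EGs,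
      Equiv.swap_inv, Equiv.swap_apply_left, Equiv.swap_apply_right] at hc
    omega
  obtain ⟨l1, m, l2, e1, e2⟩ := exchange' k l hd
  have h3 := coxLength_le (l1 ++ l2)
  rw [← e2] at h3
  simp only [List.map_cons, List.prod_cons] at h
  rw [h, e1] at h3
  simp at h3

theorem prod_fix_lt (b : ℕ) (x : List ℕ) (hx : ∀ a ∈ x, b ≤ a) (i : ℕ) (hi : i < b) :
    (x.map EGs).prod i = i := by
  induction x with
  | nil => simp
  | cons a x ih =>
    have := hx a (by simp)
    simp only [List.map_cons, List.prod_cons, Equiv.Perm.mul_apply]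
    rw [ih fun c hc => hx c (by simp [hc])]
    exact Equiv.swap_apply_of_ne_of_ne (by omega) (by omega)

theorem prod_fix_gt (b : ℕ) (x : List ℕ) (hx : ∀ a ∈ x, a < b) (i : ℕ) (hi : b < i) :
    (x.map EGs).prod i = i := by
  induction x with
  | nil => simp
  | cons a x ih =>
    have := hx a (by simp)
    simp only [List.map_cons, List.prod_cons, Equiv.Perm.mul_apply]
    rw [ih fun c hc => hx c (by simp [hc])]
    exact Equiv.swap_apply_of_ne_of_ne (by omega) (by omega)

theorem inv_fix {g : Equiv.Perm ℕ} {i : ℕ} (h : g i = i) : g⁻¹ i = i := by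
  rw [Equiv.Perm.inv_eq_iff_eq, h]

theorem EGs_ne_one (k : ℕ) : EGs k ≠ 1 := by
  intro h
  have := congrArg (fun f : Equiv.Perm ℕ => f k) h
  simp [EGs] at this

/-- Two-block reduced words fix the number of letters in each block. -/
theorem count_block (b : ℕ) (l : List ℕ) : ∀ x y : List ℕ, (∀ a ∈ x, b ≤ a) → (∀ a ∈ y, a < b) →
    ((x ++ y).map EGs).prod = (l.map EGs).prod → (x ++ y).length = l.length →
    coxLength (l.map EGs).prod = l.length →
    l.countP (fun a => decide (b ≤ a)) = x.length := by
  induction l with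
  | nil => intro x y _ _ _ hlen _; simp at hlen; simp [hlen.1]
  | cons k l ih =>
    intro x y hx hy hp hlen hred
    have hd := descent_of_reduced k l hred
    rw [← hp] at hd
    obtain ⟨l1, m, l2, e1, e2⟩ := exchange' k _ hd
    have hl : ((l1 ++ l2).map EGs).prod = (l.map EGs).prod := by
      rw [← e2, hp]
      simp only [List.map_cons, List.prod_cons]
      rw [← mul_assoc, EGs_mul_self, one_mul]
    have hlred : coxLength (l.map EGs).prod = l.length := by
      refine le_antisymm (coxLength_le l) ?_
      by_contra hc
      push Not at hc
      have hne : {n | ∃ l' : List ℕ, (l'.map EGs).prod = (l.map EGs).prod ∧ l'.length = n}.Nonempty :=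
        ⟨_, l, rfl, rfl⟩
      obtain ⟨l', h1, h2⟩ := Nat.sInf_mem hne
      have h3 := coxLength_le (k :: l')
      simp only [List.map_cons, List.prod_cons, List.length_cons] at h3 hred
      rw [h1, hred, h2] at h3
      unfold coxLength at hc
      omega
    have hlen2 : (l1 ++ l2).length = l.length := by
      have := congrArg List.length e1
      simp at this hlen ⊢
      omega
    rw [List.append_eq_append_iff] at e1
    -- either the deleted letter is in y or in x
    have key : (∃ y1 y2, y = y1 ++ m :: y2 ∧ l1 = x ++ y1 ∧ l2 = y2) ∨
        (∃ x1 x2, x = x1 ++ m :: x2 ∧ l1 = x1 ∧ l2 = x2 ++ y) := by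
      rcases e1 with ⟨as, h1, h2⟩ | ⟨bs, h1, h2⟩
      · exact Or.inl ⟨as, l2, h2, h1, rfl⟩
      · cases bs with
        | nil => exact Or.inl ⟨[], l2, by simpa using h2.symm, by simpa using h1.symm, rfl⟩
        | cons c cs =>
          simp at h2
          exact Or.inr ⟨l1, cs, by rw [h1, h2.1], rfl, h2.2⟩
    rcases key with ⟨y1, y2, hy', rfl, rfl⟩ | ⟨x1, x2, hx', rfl, rfl⟩
    · have hyy : ∀ a ∈ y1 ++ l2, a < b := by
        intro a ha; apply hy; rw [hy']; simp at ha ⊢; tauto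
      have hkb : k < b := by
        by_contra hkb
        push Not at hkb
        rw [List.append_assoc, List.map_append, List.prod_append, List.map_append,
          List.prod_append] at e2
        set g := (x.map EGs).prod with hg
        set h := (y.map EGs).prod with hh
        set h' := ((y1 ++ l2).map EGs).prod with hh'
        have e3 : g⁻¹ * EGs k * g = h' * h⁻¹ := by
          rw [eq_mul_inv_iff_mul_eq, mul_assoc, mul_assoc, e2]; simp
        have e4 : h' * h⁻¹ = 1 := by
          have hlt : ∀ i, i < b → (h' * h⁻¹) i = i := by
            intro i hi
            rw [← e3]
            have h1 := prod_fix_lt b x hx i hi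
            rw [← hg] at h1
            simp only [Equiv.Perm.mul_apply, h1]
            rw [show EGs k i = i from Equiv.swap_apply_of_ne_of_ne (by omega) (by omega)]
            exact inv_fix h1
          have hgt : ∀ i, b < i → (h' * h⁻¹) i = i := by
            intro i hi
            simp only [Equiv.Perm.mul_apply]
            rw [inv_fix (prod_fix_gt b y hy i hi)]
            exact prod_fix_gt b _ hyy i hi
          ext i
          simp only [Equiv.Perm.one_apply]
          rcases lt_trichotomy i b with h1 | h1 | h1
          · exact hlt i h1
          · by_contra hne
            subst h1
            rcases lt_or_gt_of_ne hne with h2 | h2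
            · exact hne ((h' * h⁻¹).injective (hlt _ h2))
            · exact hne ((h' * h⁻¹).injective (hgt _ h2))
          · exact hgt i h1
        rw [e4, mul_assoc, inv_mul_eq_one] at e3
        exact EGs_ne_one k (by simpa using e3.symm)
      have := ih x (y1 ++ l2) hx hyy (by simpa [mul_assoc] using hl) (by simpa using hlen2) hlred
      rw [List.countP_cons_of_neg (by simpa using hkb), this]
    · have hxx : ∀ a ∈ l1 ++ x2, b ≤ a := by
        intro a ha; apply hx; rw [hx']; simp at ha ⊢; tauto
      have hkb : b ≤ k := by
        by_contra hkb
        push Not at hkb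
        rw [← List.append_assoc] at e2
        rw [List.map_append, List.prod_append, List.map_append (l₂ := y), List.prod_append,
          ← mul_assoc] at e2
        have e3 := mul_right_cancel e2
        have e4 := congrArg (fun f : Equiv.Perm ℕ => f k) e3
        simp only [Equiv.Perm.mul_apply] at e4
        rw [prod_fix_lt b x hx k hkb, prod_fix_lt b _ hxx k hkb] at e4
        simp [EGs] at e4
      have := ih (l1 ++ x2) y hxx hy (by simpa [mul_assoc] using hl) (by simpa using hlen2) hlred
      rw [List.countP_cons_of_pos (by simpa using hkb), this, hx']
      simp
      omega

theorem prod_split (b : ℕ) (l : List ℕ)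
    (h : l.Pairwise fun a c => a < b → b ≤ c → a + 1 < c) :
    ((l.filter (fun a => decide (b ≤ a)) ++ l.filter (fun a => !decide (b ≤ a))).map EGs).prod
      = (l.map EGs).prod := by
  induction l with
  | nil => simp
  | cons k l ih =>
    rw [List.pairwise_cons] at h
    have ih := ih h.2
    simp only [List.map_append, List.prod_append] at ih
    by_cases hk : b ≤ k
    · simp [hk, mul_assoc, ih]
    · have hc : ∀ x : List ℕ, (∀ c ∈ x, k + 1 < c) →
          (x.map EGs).prod * EGs k = EGs k * (x.map EGs).prod := by
        intro x hx
        have : Commute (EGs k) (x.map EGs).prod := by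
          apply Commute.list_prod_right
          intro g hg
          obtain ⟨c, hc, rfl⟩ := List.mem_map.1 hg
          have := hx c hc
          apply Equiv.Perm.Disjoint.commute
          intro i
          by_cases hi : i = c ∨ i = c + 1
          · left; exact Equiv.swap_apply_of_ne_of_ne (by omega) (by omega)
          · right; exact Equiv.swap_apply_of_ne_of_ne (by omega) (by omega)
        exact this.symm.eq
      have := hc (l.filter (fun a => decide (b ≤ a))) (by
        intro c hc
        simp at hc
        exact h.1 c hc.1 (by omega) hc.2)
      simp only [List.filter_cons, hk, decide_false, Bool.not_false, if_true, List.map_append,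
        List.prod_append, List.map_cons, List.prod_cons, Bool.false_eq_true, if_false]
      rw [← mul_assoc, this, mul_assoc, ih]

theorem count_eq (b : ℕ) (w : Equiv.Perm ℕ) (l l' : List ℕ) (hl : IsReducedWord w l)
    (hl' : IsReducedWord w l')
    (h : l.Pairwise fun a c => a < b → b ≤ c → a + 1 < c) :
    l'.countP (fun a => decide (b ≤ a)) = l.countP (fun a => decide (b ≤ a)) := by
  obtain ⟨h1, h2⟩ := hl
  obtain ⟨h1', h2'⟩ := hl'
  have hs := prod_split b l h
  rw [count_block b l' (l.filter (fun a => decide (b ≤ a)))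
    (l.filter (fun a => !decide (b ≤ a))) (fun a ha => by simpa using (List.mem_filter.1 ha).2)
    (fun a ha => by simpa using (List.mem_filter.1 ha).2) (by rw [hs, h1, h1']) ?_
    (by rw [h1', h2'])]
  · rw [List.countP_eq_length_filter]
  · rw [h2', ← h2, List.length_append, ← List.countP_eq_length_filter,
      ← List.countP_eq_length_filter, List.length_eq_countP_add_countP (fun a => decide (b ≤ a)) (l := l)]
    congr 1
    apply List.countP_congr
    simp


-- ===== standardization =====
/-- The order on cells used by standardization. -/
def keyLe (T : ℕ → ℕ → ℕ) (c d : ℕ × ℕ) : Prop :=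
  T c.1 c.2 < T d.1 d.2 ∨ (T c.1 c.2 = T d.1 d.2 ∧ c.2 < d.2) ∨
    (T c.1 c.2 = T d.1 d.2 ∧ c.2 = d.2 ∧ c.1 ≤ d.1)

theorem keyLe_total (T : ℕ → ℕ → ℕ) (c d : ℕ × ℕ) : keyLe T c d ∨ keyLe T d c := by
  unfold keyLe; omega

theorem keyLe_trans {T : ℕ → ℕ → ℕ} {c d e : ℕ × ℕ} (h : keyLe T c d) (h' : keyLe T d e) :
    keyLe T c e := by
  unfold keyLe at *; omega

theorem keyLe_antisymm {T : ℕ → ℕ → ℕ} {c d : ℕ × ℕ} (h : keyLe T c d) (h' : keyLe T d c) :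
    c = d := by
  unfold keyLe at *; ext <;> omega

open scoped Classical in
theorem stdEntry_eq (μ : YoungDiagram) (T : ℕ → ℕ → ℕ) (d : ℕ × ℕ) (hd : d ∈ μ.cells) :
    stdEntry μ T d.1 d.2 = (μ.cells.filter fun c => keyLe T c d).card := by
  unfold stdEntry keyLe
  rw [if_pos hd]
  congr

theorem std_le_iff (μ : YoungDiagram) (T : ℕ → ℕ → ℕ) (c d : ℕ × ℕ) (hc : c ∈ μ.cells)
    (hd : d ∈ μ.cells) : stdEntry μ T c.1 c.2 ≤ stdEntry μ T d.1 d.2 ↔ keyLe T c d := by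
  classical
  rw [stdEntry_eq μ T c hc, stdEntry_eq μ T d hd]
  constructor
  · intro h
    by_contra hn
    have hdc := (keyLe_total T c d).resolve_left hn
    refine absurd h (not_le.2 (Finset.card_lt_card ?_))
    rw [Finset.ssubset_iff_of_subset]
    · refine ⟨c, ?_, ?_⟩
      · simp [hc, (keyLe_total T c c).elim id id, ← YoungDiagram.mem_cells]
      · simp [hn]
    · intro e he
      rw [Finset.mem_filter] at he ⊢
      exact ⟨he.1, keyLe_trans he.2 hdc⟩
  · intro h
    refine Finset.card_le_card ?_
    intro e he
    rw [Finset.mem_filter] at he ⊢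
    exact ⟨he.1, keyLe_trans he.2 h⟩

theorem std_mem (μ : YoungDiagram) (T : ℕ → ℕ → ℕ)
    (hr : ∀ i j1 j2, j1 < j2 → (i, j2) ∈ μ.cells → T i j1 < T i j2)
    (hc : ∀ i1 i2 j, i1 < i2 → (i2, j) ∈ μ.cells → T i1 j < T i2 j) :
    stdEntry μ T ∈ SYTset μ := by
  classical
  have hlt : ∀ c d : ℕ × ℕ, c ∈ μ.cells → d ∈ μ.cells → T c.1 c.2 < T d.1 d.2 →
      stdEntry μ T c.1 c.2 < stdEntry μ T d.1 d.2 := by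
    intro c d hc hd h
    by_contra hn
    rw [not_lt, std_le_iff μ T d c hd hc] at hn
    unfold keyLe at hn; omega
  refine ⟨?_, ?_, ?_, ?_⟩
  · intro i j1 j2 h hm
    exact hlt (i, j1) (i, j2) (μ.up_left_mem le_rfl h.le hm) hm (hr i j1 j2 h hm)
  · intro i1 i2 j h hm
    exact hlt (i1, j) (i2, j) (μ.up_left_mem h.le le_rfl hm) hm (hc i1 i2 j h hm)
  · intro i j h
    unfold stdEntry
    rw [if_neg h]
  · refine Finset.eq_of_subset_of_card_le ?_ ?_
    · intro x hx
      obtain ⟨c, hcm, rfl⟩ := Finset.mem_image.1 hx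
      rw [stdEntry_eq μ T c hcm, Finset.mem_Icc]
      refine ⟨Finset.card_pos.2 ⟨c, ?_⟩, Finset.card_le_card (Finset.filter_subset _ _)⟩
      rw [Finset.mem_filter]
      exact ⟨hcm, (keyLe_total T c c).elim id id⟩
    · rw [Finset.card_image_of_injOn, Nat.card_Icc]
      · simp [YoungDiagram.card]
      · intro c hc d hd h
        exact keyLe_antisymm ((std_le_iff μ T c d hc hd).1 h.le) ((std_le_iff μ T d c hd hc).1 h.ge)

/-- Cells in reading order. -/
def cellList (μ : YoungDiagram) : List (ℕ × ℕ) :=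
  (List.range (μ.colLen 0)).flatMap fun i =>
    ((List.range (μ.rowLen i)).reverse).map fun j => (i, j)

theorem readingWord_eq (μ : YoungDiagram) (T : ℕ → ℕ → ℕ) :
    readingWord μ T = (cellList μ).map fun c => T c.1 c.2 := by
  simp [readingWord, cellList, List.map_flatMap, Function.comp_def]

theorem mem_cellList (μ : YoungDiagram) (c : ℕ × ℕ) : c ∈ cellList μ ↔ c ∈ μ.cells := by
  obtain ⟨i, j⟩ := c
  simp only [cellList, List.mem_flatMap, List.mem_range, List.mem_map, List.mem_reverse,
    YoungDiagram.mem_cells, Prod.mk.injEq]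
  constructor
  · rintro ⟨i', _, j', h, rfl, rfl⟩
    exact YoungDiagram.mem_iff_lt_rowLen.2 h
  · intro h
    refine ⟨i, YoungDiagram.mem_iff_lt_colLen.1 (μ.up_left_mem le_rfl (Nat.zero_le j) h), j,
      YoungDiagram.mem_iff_lt_rowLen.1 h, rfl, rfl⟩

theorem cellList_pairwise (μ : YoungDiagram) :
    (cellList μ).Pairwise fun d e => d.1 < e.1 ∨ (d.1 = e.1 ∧ e.2 < d.2) := by
  unfold cellList
  rw [List.pairwise_flatMap]
  constructor
  · intro i _
    rw [List.pairwise_map, List.pairwise_reverse]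
    exact List.pairwise_lt_range.imp fun h => Or.inr ⟨rfl, h⟩
  · refine List.pairwise_lt_range.imp fun h => ?_
    intro x hx y hy
    simp only [List.mem_map] at hx hy
    obtain ⟨_, _, rfl⟩ := hx
    obtain ⟨_, _, rfl⟩ := hy
    exact Or.inl h

theorem cellList_nodup (μ : YoungDiagram) : (cellList μ).Nodup := by
  refine (cellList_pairwise μ).imp ?_
  rintro a b h rfl
  omega

theorem countP_word (μ : YoungDiagram) (T : ℕ → ℕ → ℕ) (b : ℕ) :
    (readingWord μ T).countP (fun a => decide (b ≤ a))
      = (μ.cells.filter fun c => b ≤ T c.1 c.2).card := by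
  rw [readingWord_eq, List.countP_map, List.countP_eq_length_filter,
    ← List.toFinset_card_of_nodup ((cellList_nodup μ).filter _)]
  congr 1
  ext c
  simp only [List.mem_toFinset, List.mem_filter, mem_cellList, Finset.mem_filter]
  simp

theorem std_inj_aux (μ : YoungDiagram) (w : Equiv.Perm ℕ) (T T' : ℕ → ℕ → ℕ)
    (hT : T ∈ EGset μ w) (hT' : T' ∈ EGset μ w) (h : stdEntry μ T = stdEntry μ T')
    (c : ℕ × ℕ) (hc : c ∈ μ.cells)
    (hmax : ∀ d ∈ μ.cells, stdEntry μ T c.1 c.2 < stdEntry μ T d.1 d.2 →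
      T d.1 d.2 = T' d.1 d.2)
    (hlt : T c.1 c.2 < T' c.1 c.2) : False := by
  obtain ⟨g1, g2, -, h4⟩ := hT
  obtain ⟨h1', h2', -, h4'⟩ := hT'
  set b := T' c.1 c.2 with hb
  -- a cell strictly above `c` in the order of `T` gets equal entries
  have hup : ∀ d ∈ μ.cells, ¬ keyLe T d c → T d.1 d.2 = T' d.1 d.2 ∧ keyLe T' c d := by
    intro d hd hn
    rw [← std_le_iff μ T d c hd hc, not_le] at hn
    refine ⟨hmax d hd hn, ?_⟩
    rw [← std_le_iff μ T' c d hc hd, ← h]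
    exact hn.le
  have hcount := count_eq b w _ _ h4 h4' ?_
  · rw [countP_word, countP_word] at hcount
    refine absurd hcount (Nat.ne_of_gt (Finset.card_lt_card ?_))
    rw [Finset.ssubset_iff_of_subset]
    · refine ⟨c, ?_, ?_⟩
      · rw [Finset.mem_filter]; exact ⟨hc, le_rfl⟩
      · rw [Finset.mem_filter]; intro hx; omega
    · intro d hd
      rw [Finset.mem_filter] at hd ⊢
      refine ⟨hd.1, ?_⟩
      rw [← (hup d hd.1 (by unfold keyLe; omega)).1]
      exact hd.2
  · rw [readingWord_eq, List.pairwise_map]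
    refine List.Pairwise.imp_of_mem ?_ (cellList_pairwise μ)
    intro d e hd he hde h1 h2
    rw [mem_cellList] at hd he
    by_contra hcon
    obtain ⟨he1, he2⟩ := hup e he (by unfold keyLe; omega)
    have hdc : keyLe T d c := by
      by_contra hn
      obtain ⟨hd1, hd2⟩ := hup d hd hn
      unfold keyLe at hd2
      omega
    -- column/row comparisons
    have hce : c.2 < e.2 := by
      by_contra hn
      have h5 : c.2 = e.2 ∧ c.1 ≤ e.1 := by unfold keyLe at he2; omega
      rcases h5.2.lt_or_eq with h6 | h6
      · have := h2' c.1 e.1 e.2 h6 he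
        rw [← h5.1] at this
        rw [← h5.1] at he1 hcon
        omega
      · have : c = e := Prod.ext h6 h5.1
        subst this
        omega
    have hce1 : e.1 < c.1 := by
      by_contra hn
      push Not at hn
      have h5 := h1' e.1 c.2 e.2 hce he
      rcases hn.lt_or_eq with h6 | h6
      · have := h2' c.1 e.1 c.2 h6 (μ.up_left_mem le_rfl hce.le he)
        omega
      · rw [← h6] at h5 
        rw [← h6] at he1 hcon
        omega
    have hdr : c.1 ≤ d.1 := by
      by_contra hn
      push Not at hn
      have h5 : T d.1 d.2 = T c.1 c.2 ∧ d.2 ≤ c.2 := by unfold keyLe at hdc; omega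
      have h6 := g2 d.1 c.1 c.2 hn hc
      rcases h5.2.lt_or_eq with h7 | h7
      · have := g1 d.1 d.2 c.2 h7 (μ.up_left_mem hn.le le_rfl hc)
        omega
      · rw [h7] at h5
        omega
    omega

theorem std_inj (μ : YoungDiagram) (w : Equiv.Perm ℕ) (T T' : ℕ → ℕ → ℕ)
    (hT : T ∈ EGset μ w) (hT' : T' ∈ EGset μ w) (h : stdEntry μ T = stdEntry μ T') : T = T' := by
  classical
  by_contra hne
  have hex : (μ.cells.filter fun c => T c.1 c.2 ≠ T' c.1 c.2).Nonempty := by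
    by_contra hn
    rw [Finset.not_nonempty_iff_eq_empty, Finset.filter_eq_empty_iff] at hn
    apply hne
    funext i j
    by_cases hij : (i, j) ∈ μ.cells
    · simpa using hn hij
    · rw [hT.2.2.1 i j hij, hT'.2.2.1 i j hij]
  obtain ⟨c, hc, hmax⟩ := Finset.exists_max_image _ (fun c => stdEntry μ T c.1 c.2) hex
  rw [Finset.mem_filter] at hc
  have hm : ∀ d ∈ μ.cells, stdEntry μ T c.1 c.2 < stdEntry μ T d.1 d.2 →
      T d.1 d.2 = T' d.1 d.2 := by
    intro d hd hlt
    by_contra hn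
    have := hmax d (Finset.mem_filter.2 ⟨hd, hn⟩)
    omega
  rcases lt_or_gt_of_ne hc.2 with h1 | h1
  · exact std_inj_aux μ w T T' hT hT' h c hc.1 hm h1
  · refine std_inj_aux μ w T' T hT' hT h.symm c hc.1 ?_ h1
    intro d hd hlt
    rw [← h] at hlt
    exact (hm d hd hlt).symm


-- ===== counting chains of Young diagrams =====
theorem finite_level (n : ℕ) : {μ : YoungDiagram | μ.card = n}.Finite := by
  have hfin : (((Finset.range n ×ˢ Finset.range n).powerset : Finset (Finset (ℕ × ℕ))) :
      Set (Finset (ℕ × ℕ))).Finite := Finset.finite_toSet _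
  refine Set.Finite.of_finite_image (f := YoungDiagram.cells) (hfin.subset ?_) ?_
  · rintro _ ⟨μ, hμ, rfl⟩
    simp only [Set.mem_ofPred_eq] at hμ
    rw [Finset.mem_coe, Finset.mem_powerset]
    rintro ⟨i, j⟩ hij
    have h1 : (Finset.range (i + 1)).card ≤ μ.cells.card := by
      refine Finset.card_le_card_of_injOn (fun k => (k, j)) ?_ ?_
      · intro k hk
        simp only [Finset.coe_range, Set.mem_Iio] at hk
        exact μ.up_left_mem (by omega) le_rfl hij
      · intro a _ b _ h; simpa using h
    have h2 : (Finset.range (j + 1)).card ≤ μ.cells.card := by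
      refine Finset.card_le_card_of_injOn (fun k => (i, k)) ?_ ?_
      · intro k hk
        simp only [Finset.coe_range, Set.mem_Iio] at hk
        exact μ.up_left_mem le_rfl (by omega) hij
      · intro a _ b _ h; simpa using h
    rw [Finset.card_range] at h1 h2
    change μ.cells.card = n at hμ
    rw [Finset.mem_product, Finset.mem_range, Finset.mem_range]
    dsimp only
    omega
  · intro a _ b _ h
    exact YoungDiagram.ext h

/-- Young diagrams of size `n`. -/
noncomputable def lev (n : ℕ) : Finset YoungDiagram := (finite_level n).toFinset

theorem mem_lev {n : ℕ} {μ : YoungDiagram} : μ ∈ lev n ↔ μ.cells.card = n := by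
  simp [lev, YoungDiagram.card]

open scoped Classical in
/-- Lower covers at level `n`. -/
noncomputable def dn (n : ℕ) (μ : YoungDiagram) : Finset YoungDiagram := (lev n).filter (· ≤ μ)

open scoped Classical in
/-- Upper covers at level `n`. -/
noncomputable def up (n : ℕ) (μ : YoungDiagram) : Finset YoungDiagram := (lev n).filter (μ ≤ ·)

theorem mem_dn {n : ℕ} {μ ν : YoungDiagram} : ν ∈ dn n μ ↔ ν.cells.card = n ∧ ν ≤ μ := by
  simp [dn, mem_lev]

theorem mem_up {n : ℕ} {μ ν : YoungDiagram} : ν ∈ up n μ ↔ ν.cells.card = n ∧ μ ≤ ν := by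
  simp [up, mem_lev]

/-- Number of saturated chains from the empty diagram. -/
noncomputable def chains : ℕ → YoungDiagram → ℕ
  | 0, _ => 1
  | n + 1, μ => ∑ ν ∈ dn n μ, chains n ν

theorem eq_of_le_card {μ ν : YoungDiagram} (h : μ ≤ ν) (hc : ν.cells.card ≤ μ.cells.card) :
    μ = ν :=
  YoungDiagram.ext (Finset.eq_of_subset_of_card_le (YoungDiagram.cells_subset_iff.2 h) hc)

open scoped Classical in
theorem up_common (n : ℕ) (κ ν : YoungDiagram) (hκ : κ ∈ lev (n + 1)) (hν : ν ∈ lev (n + 1))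
    (hne : κ ≠ ν) :
    ((up (n + 2) κ).filter (fun l => l ∈ up (n + 2) ν)).card
      ≤ ((dn n κ).filter (fun l => l ∈ dn n ν)).card := by
  classical
  rw [mem_lev] at hκ hν
  rcases Finset.eq_empty_or_nonempty ((up (n + 2) κ).filter (fun l => l ∈ up (n + 2) ν))
    with h | ⟨l, hl⟩
  · rw [h]; simp
  have key : ∀ l ∈ (up (n + 2) κ).filter (fun l => l ∈ up (n + 2) ν),
      κ ⊔ ν = l ∧ n + 2 = (κ ⊔ ν).cells.card := by
    intro l hl
    rw [Finset.mem_filter, mem_up, mem_up] at hl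
    have h1 : κ ⊔ ν ≤ l := sup_le hl.1.2 hl.2.2
    have h2 : n + 2 ≤ (κ ⊔ ν).cells.card := by
      by_contra hc
      have e1 : κ = κ ⊔ ν := eq_of_le_card le_sup_left (by omega)
      have e2 : ν = κ ⊔ ν := eq_of_le_card le_sup_right (by omega)
      exact hne (e1.trans e2.symm)
    have h3 : (κ ⊔ ν) = l := eq_of_le_card h1 (by omega)
    exact ⟨h3, by rw [h3]; exact hl.1.1.symm⟩
  have h1 : ((up (n + 2) κ).filter (fun l => l ∈ up (n + 2) ν)).card ≤ 1 := by
    rw [Finset.card_le_one]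
    intro a ha b hb
    rw [← (key a ha).1, ← (key b hb).1]
  refine h1.trans (Finset.card_pos.2 ⟨κ ⊓ ν, ?_⟩)
  have h2 := (key l hl).2
  have h3 := Finset.card_union_add_card_inter κ.cells ν.cells
  rw [← YoungDiagram.cells_sup, ← YoungDiagram.cells_inf] at h3
  rw [Finset.mem_filter, mem_dn, mem_dn]
  have h4 : (κ ⊓ ν).cells.card = n := by omega
  exact ⟨⟨h4, inf_le_left⟩, ⟨h4, inf_le_right⟩⟩

/-- The diagram with a corner removed. -/
def eraseCorner (μ : YoungDiagram) (c : ℕ × ℕ) (h1 : (c.1 + 1, c.2) ∉ μ) (h2 : (c.1, c.2 + 1) ∉ μ) :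
    YoungDiagram where
  cells := μ.cells.erase c
  isLowerSet := by
    rintro ⟨a1, a2⟩ ⟨b1, b2⟩ hab ha
    rw [Finset.mem_coe, Finset.mem_erase] at ha ⊢
    obtain ⟨h3, h4⟩ := hab
    dsimp only at h3 h4
    refine ⟨?_, μ.up_left_mem h3 h4 ha.2⟩
    rintro rfl
    by_cases h5 : b1 < a1
    · exact h1 (μ.up_left_mem h5 h4 ha.2)
    · by_cases h6 : b2 < a2
      · exact h2 (μ.up_left_mem h3 h6 ha.2)
      · exact ha.1 (Prod.ext (by dsimp only; omega) (by dsimp only; omega))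

/-- Row of the cell in which two diagrams differ. -/
def rowDiff (ν μ : YoungDiagram) : ℕ := ∑ c ∈ μ.cells \ ν.cells, c.1

theorem diff_cell {ν μ : YoungDiagram} (h : ν ≤ μ) (hc : μ.cells.card = ν.cells.card + 1) :
    ∃ c, μ.cells \ ν.cells = {c} := by
  rw [← Finset.card_eq_one, Finset.card_sdiff_of_subset (YoungDiagram.cells_subset_iff.2 h)]
  omega

theorem up_row {n : ℕ} {μ l : YoungDiagram} (hμ : μ.cells.card = n) (hl : l ∈ up (n + 1) μ) :
    l.cells \ μ.cells = {(rowDiff μ l, μ.rowLen (rowDiff μ l))} := by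
  rw [mem_up] at hl
  obtain ⟨⟨i, j⟩, hc⟩ := diff_cell hl.2 (by omega)
  have hr : rowDiff μ l = i := by unfold rowDiff; rw [hc]; simp
  have hm : (i, j) ∈ l.cells \ μ.cells := by rw [hc]; simp
  rw [Finset.mem_sdiff] at hm
  have h1 : μ.rowLen i ≤ j := by
    by_contra hn
    exact hm.2 (YoungDiagram.mem_iff_lt_rowLen.2 (by omega))
  have h2 : j ≤ μ.rowLen i := by
    by_contra hn
    have h3 : (i, μ.rowLen i) ∈ l.cells \ μ.cells := by
      rw [Finset.mem_sdiff]
      refine ⟨l.up_left_mem le_rfl (by omega) hm.1, ?_⟩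
      intro h
      exact lt_irrefl _ (YoungDiagram.mem_iff_lt_rowLen.1 h)
    rw [hc, Finset.mem_singleton, Prod.mk.injEq] at h3
    omega
  rw [hc, hr]
  congr 2
  omega

theorem up_card (n : ℕ) (μ : YoungDiagram) (hμ : μ ∈ lev (n + 1)) :
    (up (n + 2) μ).card ≤ 1 + (dn n μ).card := by
  classical
  rw [mem_lev] at hμ
  have hinj : Set.InjOn (rowDiff μ) (up (n + 2) μ : Set YoungDiagram) := by
    intro a ha b hb h
    have h1 := up_row hμ ha
    have h2 := up_row hμ hb
    rw [h, ← h2] at h1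
    have ha' := YoungDiagram.cells_subset_iff.2 (mem_up.1 ha).2
    have hb' := YoungDiagram.cells_subset_iff.2 (mem_up.1 hb).2
    apply YoungDiagram.ext
    rw [← Finset.sdiff_union_of_subset ha', h1, Finset.sdiff_union_of_subset hb']
  rw [← Finset.card_image_of_injOn hinj]
  have hsub : (up (n + 2) μ).image (rowDiff μ) ⊆
      insert 0 ((dn n μ).image (fun ν => rowDiff ν μ + 1)) := by
    intro i hi
    obtain ⟨l, hl, rfl⟩ := Finset.mem_image.1 hi
    have h1 := up_row hμ hl
    rcases Nat.eq_zero_or_pos (rowDiff μ l) with h0 | h0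
    · rw [h0]; exact Finset.mem_insert_self _ _
    obtain ⟨i, hi'⟩ : ∃ i, rowDiff μ l = i + 1 := ⟨rowDiff μ l - 1, by omega⟩
    rw [hi'] at h1 ⊢
    have hm : (i + 1, μ.rowLen (i + 1)) ∈ l.cells \ μ.cells := by rw [h1]; simp
    rw [Finset.mem_sdiff] at hm
    have hm2 : (i, μ.rowLen (i + 1)) ∈ μ := by
      by_contra hn
      have : (i, μ.rowLen (i + 1)) ∈ l.cells \ μ.cells := by
        rw [Finset.mem_sdiff]
        exact ⟨l.up_left_mem (Nat.le_succ i) le_rfl hm.1, hn⟩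
      rw [h1, Finset.mem_singleton, Prod.mk.injEq] at this
      omega
    have hlt := YoungDiagram.mem_iff_lt_rowLen.1 hm2
    have hcm : (i, μ.rowLen i - 1) ∈ μ := YoungDiagram.mem_iff_lt_rowLen.2 (by omega)
    have c1 : (i + 1, μ.rowLen i - 1) ∉ μ := by
      rw [YoungDiagram.mem_iff_lt_rowLen]; omega
    have c2 : (i, μ.rowLen i - 1 + 1) ∉ μ := by
      rw [YoungDiagram.mem_iff_lt_rowLen]; omega
    refine Finset.mem_insert_of_mem (Finset.mem_image.2
      ⟨eraseCorner μ (i, μ.rowLen i - 1) c1 c2, ?_, ?_⟩)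
    · rw [mem_dn]
      refine ⟨?_, ?_⟩
      · change (μ.cells.erase _).card = n
        rw [Finset.card_erase_of_mem hcm]; omega
      · rw [← YoungDiagram.cells_subset_iff]
        exact Finset.erase_subset _ _
    · unfold rowDiff
      change ∑ c ∈ μ.cells \ μ.cells.erase _, c.1 + 1 = _
      rw [Finset.sdiff_erase_self hcm]
      simp
  refine (Finset.card_le_card hsub).trans ((Finset.card_insert_le _ _).trans ?_)
  have : ((dn n μ).image (fun ν => rowDiff ν μ + 1)).card ≤ (dn n μ).card := Finset.card_image_le
  omega

theorem lev_zero {μ : YoungDiagram} (h : μ ∈ lev 0) : μ = ⊥ := by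
  rw [mem_lev, Finset.card_eq_zero] at h
  exact YoungDiagram.ext h

theorem up_card_zero (μ : YoungDiagram) (hμ : μ ∈ lev 0) : (up 1 μ).card ≤ 1 := by
  rw [Finset.card_le_one]
  have hz := mem_lev.1 hμ
  have hm := lev_zero hμ
  have key : ∀ l ∈ up 1 μ, l.cells = {(0, 0)} := by
    intro l hl
    rw [mem_up] at hl
    obtain ⟨c, hc⟩ := Finset.card_eq_one.1 hl.1
    have : (0, 0) ∈ l.cells := l.up_left_mem (Nat.zero_le c.1) (Nat.zero_le c.2)
      (show c ∈ l.cells by rw [hc]; simp)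
    rw [hc, Finset.mem_singleton] at this
    rw [hc, this]
  intro a ha b hb
  exact YoungDiagram.ext ((key a ha).trans (key b hb).symm)

open scoped Classical in
theorem sum_dn_swap (n m : ℕ) (S : Finset YoungDiagram) (g : YoungDiagram → ℕ) 
    (hS : ∀ μ ∈ S, μ ∈ lev m) :
    ∑ μ ∈ S, ∑ κ ∈ dn n μ, g κ = ∑ κ ∈ lev n, ((up m κ).filter (· ∈ S)).card * g κ := by
  classical
  simp only [dn, Finset.sum_filter]
  rw [Finset.sum_comm]
  refine Finset.sum_congr rfl fun κ _ => ?_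
  rw [← Finset.sum_filter, Finset.sum_const, smul_eq_mul]
  congr 2
  ext μ
  simp only [Finset.mem_filter, up]
  constructor
  · rintro ⟨h1, h2⟩; exact ⟨⟨hS _ h1, h2⟩, h1⟩
  · rintro ⟨⟨_, h2⟩, h1⟩; exact ⟨h1, h2⟩

open scoped Classical in
theorem sum_up_swap (n m : ℕ) (S : Finset YoungDiagram) (g : YoungDiagram → ℕ) 
    (hS : ∀ μ ∈ S, μ ∈ lev m) :
    ∑ μ ∈ S, ∑ κ ∈ up n μ, g κ = ∑ κ ∈ lev n, ((dn m κ).filter (· ∈ S)).card * g κ := by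
  classical
  simp only [up, Finset.sum_filter]
  rw [Finset.sum_comm]
  refine Finset.sum_congr rfl fun κ _ => ?_
  rw [← Finset.sum_filter, Finset.sum_const, smul_eq_mul]
  congr 2
  ext μ
  simp only [Finset.mem_filter, dn]
  constructor
  · rintro ⟨h1, h2⟩; exact ⟨⟨hS _ h1, h2⟩, h1⟩
  · rintro ⟨⟨_, h2⟩, h1⟩; exact ⟨h1, h2⟩

theorem up_sub {n : ℕ} {ν μ : YoungDiagram} (h : μ ∈ up n ν) : μ ∈ lev n :=
  mem_lev.2 (mem_up.1 h).1

theorem dn_sub {n : ℕ} {ν μ : YoungDiagram} (h : μ ∈ dn n ν) : μ ∈ lev n :=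
  mem_lev.2 (mem_dn.1 h).1

theorem chains_up (n : ℕ) : ∀ ν ∈ lev n, ∑ μ ∈ up (n + 1) ν, chains (n + 1) μ ≤ (n + 1) * chains n ν := by
  classical
  induction n with
  | zero =>
    intro ν hν
    have h1 : ∀ μ ∈ up 1 ν, chains 1 μ ≤ 1 := by
      intro μ _
      simp only [chains, Finset.sum_const, smul_eq_mul, mul_one]
      rw [Finset.card_le_one]
      intro a ha b hb
      rw [lev_zero (dn_sub ha), lev_zero (dn_sub hb)]
    refine (Finset.sum_le_sum h1).trans ?_
    simpa [chains] using up_card_zero ν hν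
  | succ n ih =>
    intro ν hν
    have e1 : ∑ μ ∈ up (n + 2) ν, chains (n + 2) μ
        = ∑ κ ∈ lev (n + 1), ((up (n + 2) κ).filter (· ∈ up (n + 2) ν)).card * chains (n + 1) κ := by
      rw [← sum_dn_swap (n + 1) (n + 2) _ _ fun μ h => up_sub h]
      rfl
    have e2 : ∑ ρ ∈ dn n ν, ∑ κ ∈ up (n + 1) ρ, chains (n + 1) κ
        = ∑ κ ∈ lev (n + 1), ((dn n κ).filter (· ∈ dn n ν)).card * chains (n + 1) κ := by
      rw [← sum_up_swap (n + 1) n _ _ fun μ h => dn_sub h]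
    have e3 : ∑ ρ ∈ dn n ν, ∑ κ ∈ up (n + 1) ρ, chains (n + 1) κ ≤ (n + 1) * chains (n + 1) ν := by
      conv_rhs => rw [chains, Finset.mul_sum]
      exact Finset.sum_le_sum fun ρ hρ => ih ρ (dn_sub hρ)
    have e4 : ∑ κ ∈ lev (n + 1), ((up (n + 2) κ).filter (· ∈ up (n + 2) ν)).card * chains (n + 1) κ
        ≤ ∑ κ ∈ lev (n + 1), (((dn n κ).filter (· ∈ dn n ν)).card * chains (n + 1) κ
            + if κ = ν then chains (n + 1) ν else 0) := by
      refine Finset.sum_le_sum fun κ hκ => ?_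
      by_cases h : κ = ν
      · subst h
        have := up_card n κ hκ
        simp only [Finset.filter_mem_eq_inter, Finset.inter_self, if_true]
        nlinarith
      · rw [if_neg h, add_zero]
        exact Nat.mul_le_mul_right _ (up_common n κ ν hκ hν h)
    rw [Finset.sum_add_distrib, Finset.sum_ite_eq' (lev (n + 1)) ν, if_pos hν, ← e2] at e4
    rw [e1]
    calc _ ≤ _ := e4
      _ ≤ (n + 1) * chains (n + 1) ν + chains (n + 1) ν := by omega
      _ = _ := by ring

/-- Total number of chains. -/
noncomputable def tot (n : ℕ) : ℕ := ∑ μ ∈ lev n, chains n μ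

theorem tot_zero : tot 0 ≤ 1 := by
  simp only [tot, chains, Finset.sum_const, smul_eq_mul, mul_one]
  rw [Finset.card_le_one]
  intro a ha b hb
  rw [lev_zero ha, lev_zero hb]

theorem tot_succ (n : ℕ) : tot (n + 1) = ∑ κ ∈ lev n, (up (n + 1) κ).card * chains n κ := by
  classical
  have := sum_dn_swap n (n + 1) (lev (n + 1)) (chains n) fun μ h => h
  unfold tot
  rw [show ∑ μ ∈ lev (n + 1), chains (n + 1) μ = ∑ μ ∈ lev (n + 1), ∑ κ ∈ dn n μ, chains n κ from rfl,
    this]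
  refine Finset.sum_congr rfl fun κ _ => ?_
  congr 2
  rw [Finset.filter_eq_self]
  exact fun μ h => up_sub h

theorem tot_one : tot 1 ≤ 1 := by
  rw [tot_succ]
  refine le_trans (Finset.sum_le_sum fun κ hκ => Nat.mul_le_mul_right _ (up_card_zero κ hκ)) ?_
  simpa [tot] using tot_zero

theorem tot_rec (n : ℕ) : tot (n + 2) ≤ tot (n + 1) + (n + 1) * tot n := by
  classical
  rw [tot_succ]
  refine le_trans (Finset.sum_le_sum fun κ hκ => Nat.mul_le_mul_right _ (up_card n κ hκ)) ?_
  simp only [add_mul, one_mul, Finset.sum_add_distrib]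
  have h1 : ∑ κ ∈ lev (n + 1), (dn n κ).card * chains (n + 1) κ
      = ∑ ρ ∈ lev n, ∑ κ ∈ up (n + 1) ρ, chains (n + 1) κ := by
    rw [sum_up_swap (n + 1) n (lev n) _ fun μ h => h]
    refine Finset.sum_congr rfl fun κ _ => ?_
    congr 2
    symm
    rw [Finset.filter_eq_self]
    exact fun μ h => dn_sub h
  rw [h1]
  have h2 := Finset.sum_le_sum (chains_up n)
  rw [← Finset.mul_sum, add_mul, one_mul] at h2
  exact Nat.add_le_add_left h2 _

-- ===== involutions =====
theorem inv_rec (n : ℕ) :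
    Nat.card {σ : Equiv.Perm (Fin (n + 1)) // σ * σ = 1}
      + (n + 1) * Nat.card {σ : Equiv.Perm (Fin n) // σ * σ = 1}
      ≤ Nat.card {σ : Equiv.Perm (Fin (n + 2)) // σ * σ = 1} := by
  classical
  have hsome : ∀ (σ : Equiv.Perm (Fin (n + 1))) (a : Fin (n + 1)), σ * σ = 1 → σ a = a →
      (Equiv.swap none (some a) * Equiv.optionCongr σ) *
        (Equiv.swap none (some a) * Equiv.optionCongr σ) = 1 := by
    intro σ a h ha
    have hσ : ∀ x, σ (σ x) = x := fun x => by
      have := congrArg (fun f : Equiv.Perm (Fin (n + 1)) => f x) h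
      simpa using this
    have hne : ∀ x, x ≠ a → σ x ≠ a := fun x hx hxa => hx (σ.injective (hxa.trans ha.symm))
    ext1 x
    rcases x with _ | x
    · simp [ha]
    · by_cases hx : x = a
      · subst hx; simp [ha]
      · have h1 : Equiv.swap none (some a) (some (σ x)) = some (σ x) :=
          Equiv.swap_apply_of_ne_of_ne (by simp) (by simpa using hne x hx)
        have h2 : Equiv.swap none (some a) (some x) = some x :=
          Equiv.swap_apply_of_ne_of_ne (by simp) (by simpa using hx)
        simp [h1, h2, hσ]
  let φ (a : Fin (n + 1)) : Equiv.Perm (Fin n) →* Equiv.Perm (Fin (n + 1)) :=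
    Equiv.Perm.viaEmbeddingHom (Fin.succAboveEmb a)
  have hφ : ∀ a τ, φ a τ a = a := by
    intro a τ
    apply Equiv.Perm.viaEmbedding_apply_of_notMem
    simp
  let E : Equiv.Perm (Option (Fin (n + 1))) ≃* Equiv.Perm (Fin (n + 2)) :=
    (finSuccEquiv (n + 1)).symm.permCongrHom
  let F : {σ : Equiv.Perm (Fin (n + 1)) // σ * σ = 1} ⊕
      Fin (n + 1) × {σ : Equiv.Perm (Fin n) // σ * σ = 1} →
      {σ : Equiv.Perm (Fin (n + 2)) // σ * σ = 1} := fun s =>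
    match s with
    | Sum.inl σ => ⟨E (Equiv.Perm.decomposeOption.symm (none, σ.1)), by
        rw [← map_mul, map_eq_one_iff E E.injective]
        have hσ : ∀ x, σ.1 (σ.1 x) = x := fun x => by
          have := congrArg (fun f : Equiv.Perm (Fin (n + 1)) => f x) σ.2
          simpa using this
        ext1 x
        rcases x with _ | x <;> simp [Equiv.Perm.decomposeOption, hσ]⟩
    | Sum.inr (a, τ) => ⟨E (Equiv.Perm.decomposeOption.symm (some a, φ a τ.1)), by
        rw [← map_mul, map_eq_one_iff E E.injective]
        exact hsome _ a (by rw [← map_mul, τ.2, map_one]) (hφ a τ.1)⟩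
  have hF : Function.Injective F := by
    rintro (σ | ⟨a, τ⟩) (σ' | ⟨a', τ'⟩) h
    all_goals
      have h := congrArg Subtype.val h
      have h := Equiv.Perm.decomposeOption.symm.injective (E.injective h)
      simp only [Prod.mk.injEq] at h
    · rw [Subtype.ext h.2]
    · simp at h
    · simp at h
    · obtain ⟨h1, h2⟩ := h
      obtain rfl := Option.some.inj h1
      have := Equiv.Perm.viaEmbeddingHom_injective _ h2
      rw [Subtype.ext this]
  have := Nat.card_le_card_of_injective F hF
  rwa [Nat.card_sum, Nat.card_prod, Nat.card_fin] at this

theorem tot_le (n : ℕ) : tot n ≤ Nat.card {σ : Equiv.Perm (Fin n) // σ * σ = 1} := by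
  have hpos : ∀ n, 1 ≤ Nat.card {σ : Equiv.Perm (Fin n) // σ * σ = 1} := fun n => by
    have : Nonempty {σ : Equiv.Perm (Fin n) // σ * σ = 1} := ⟨⟨1, by simp⟩⟩
    exact Nat.card_pos
  induction n using Nat.strong_induction_on with
  | _ n ih =>
    match n with
    | 0 => exact tot_zero.trans (hpos 0)
    | 1 => exact tot_one.trans (hpos 1)
    | n + 2 =>
      refine (tot_rec n).trans (le_trans ?_ (inv_rec n))
      exact Nat.add_le_add (ih _ (by omega)) (Nat.mul_le_mul_left _ (ih _ (by omega)))

-- ===== standard tableaux =====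
theorem syt_bound (n : ℕ) : ∀ μ : YoungDiagram, μ.cells.card = n →
    ∃ F : Finset (ℕ → ℕ → ℕ), SYTset μ ⊆ F ∧ F.card ≤ chains n μ := by
  classical
  induction n with
  | zero =>
    intro μ hμ
    refine ⟨{fun _ _ => 0}, ?_, by simp [chains]⟩
    rintro T ⟨-, -, h, -⟩
    rw [Finset.coe_singleton, Set.mem_singleton_iff]
    funext i j
    apply h
    rw [Finset.card_eq_zero] at hμ
    rw [hμ]; simp
  | succ n ih =>
    intro μ hμ
    choose! F hF1 hF2 using ih
    let ext (ν : YoungDiagram) (T : ℕ → ℕ → ℕ) : ℕ → ℕ → ℕ := fun i j =>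
      if (i, j) ∈ μ.cells \ ν.cells then n + 1 else T i j
    refine ⟨(dn n μ).biUnion fun ν => (F ν).image (ext ν), ?_, ?_⟩
    · rintro T ⟨h1, h2, h3, h4⟩
      have hcard : μ.card = n + 1 := hμ
      rw [hcard] at h4
      have hle : ∀ c ∈ μ.cells, 1 ≤ T c.1 c.2 ∧ T c.1 c.2 ≤ n + 1 := by
        intro c hc
        have : T c.1 c.2 ∈ Finset.Icc 1 (n + 1) := by
          rw [← h4]; exact Finset.mem_image_of_mem _ hc
        simpa using this
      have hinj : Set.InjOn (fun c : ℕ × ℕ => T c.1 c.2) μ.cells := by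
        rw [← Finset.card_image_iff, h4, hμ]; simp
      have hmax : n + 1 ∈ μ.cells.image (fun c => T c.1 c.2) := by rw [h4]; simp
      obtain ⟨c, hc, hcT⟩ := Finset.mem_image.1 hmax
      have c1 : (c.1 + 1, c.2) ∉ μ := by
        intro h
        have := h2 c.1 (c.1 + 1) c.2 (by omega) h
        have := (hle _ h).2
        dsimp only at this
        omega
      have c2 : (c.1, c.2 + 1) ∉ μ := by
        intro h
        have := h1 c.1 c.2 (c.2 + 1) (by omega) h
        have := (hle _ h).2
        dsimp only at this
        omega
      let ν := eraseCorner μ c c1 c2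
      have hν : ν.cells = μ.cells.erase c := rfl
      have hνc : ν.cells.card = n := by rw [hν, Finset.card_erase_of_mem hc]; omega
      have hdiff : μ.cells \ ν.cells = {c} := by rw [hν, Finset.sdiff_erase_self hc]
      let T' : ℕ → ℕ → ℕ := fun i j => if (i, j) = c then 0 else T i j
      have hT'lt : ∀ d e : ℕ × ℕ, e ∈ ν.cells → T d.1 d.2 < T e.1 e.2 →
          T' d.1 d.2 < T' e.1 e.2 := by
        intro d e he h
        have hec : e ≠ c := by rw [hν] at he; exact Finset.ne_of_mem_erase he
        simp only [T', Prod.mk.eta, if_neg hec]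
        split_ifs <;> omega
      have hT' : T' ∈ SYTset ν := by
        refine ⟨?_, ?_, ?_, ?_⟩
        · intro i j1 j2 h hm
          exact hT'lt (i, j1) (i, j2) hm (h1 i j1 j2 h (Finset.mem_of_mem_erase hm))
        · intro i1 i2 j h hm
          exact hT'lt (i1, j) (i2, j) hm (h2 i1 i2 j h (Finset.mem_of_mem_erase hm))
        · intro i j h
          simp only [T']
          split_ifs with hh
          · rfl
          · apply h3
            intro hm
            exact h (by rw [hν]; exact Finset.mem_erase.2 ⟨hh, hm⟩)
        · have hνn : ν.card = n := hνc
          rw [hνn]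
          have e1 : ν.cells.image (fun c => T' c.1 c.2) = ν.cells.image (fun c => T c.1 c.2) := by
            apply Finset.image_congr
            intro e he
            have hec : e ≠ c := Finset.ne_of_mem_erase he
            simp only [T', Prod.mk.eta, if_neg hec]
          rw [e1]
          refine Finset.eq_of_subset_of_card_le ?_ ?_
          · intro x hx
            obtain ⟨e, he, rfl⟩ := Finset.mem_image.1 hx
            have hem := Finset.mem_of_mem_erase he
            have hec : e ≠ c := Finset.ne_of_mem_erase he
            have := hle e hem
            have hne : T e.1 e.2 ≠ n + 1 := fun h => hec (hinj hem hc (h.trans hcT.symm))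
            rw [Finset.mem_Icc]
            omega
          · rw [Finset.card_image_of_injOn (hinj.mono ?_), hνc]
            · simp
            · intro e he
              exact Finset.mem_of_mem_erase he
      rw [Finset.mem_coe, Finset.mem_biUnion]
      refine ⟨ν, mem_dn.2 ⟨hνc, ?_⟩, Finset.mem_image.2 ⟨T', hF1 ν hνc hT', ?_⟩⟩
      · rw [← YoungDiagram.cells_subset_iff]
        exact Finset.erase_subset _ _
      · funext i j
        simp only [ext, hdiff, T', Finset.mem_singleton]
        split_ifs with hh
        · rw [← hcT, ← hh]
        · rfl
    · refine Finset.card_biUnion_le.trans ?_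
      rw [chains]
      refine Finset.sum_le_sum fun ν hν => ?_
      exact Finset.card_image_le.trans (hF2 ν (mem_dn.1 hν).1)

/-- `EG(w) = Σ_λ a_{w,λ}` is at most the number of involutions in `S_{ℓ(w)}`. -/
theorem stmt10 (w : Equiv.Perm ℕ) (n : ℕ) (l : List ℕ)
    (hl : IsReducedWord w l) (hn : l.length = n) :
    Nat.card {p : YoungDiagram × (ℕ → ℕ → ℕ) // p.1.card = n ∧ p.2 ∈ EGset p.1 w}
      ≤ Nat.card {σ : Equiv.Perm (Fin n) // σ * σ = 1} := by
  classical
  choose! F hF1 hF2 using syt_bound n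
  let G : Finset (Σ _ : YoungDiagram, (ℕ → ℕ → ℕ)) := (lev n).sigma F
  have hG : G.card ≤ tot n := by
    rw [Finset.card_sigma]
    exact Finset.sum_le_sum fun μ hμ => hF2 μ (mem_lev.1 hμ)
  refine le_trans ?_ (hG.trans (tot_le n))
  let f : {p : YoungDiagram × (ℕ → ℕ → ℕ) // p.1.card = n ∧ p.2 ∈ EGset p.1 w} → G :=
    fun p => ⟨⟨p.1.1, stdEntry p.1.1 p.1.2⟩, by
      rw [Finset.mem_sigma]
      exact ⟨mem_lev.2 p.2.1, hF1 _ p.2.1 (std_mem _ _ p.2.2.1 p.2.2.2.1)⟩⟩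
  have hf : Function.Injective f := by
    rintro ⟨⟨μ, T⟩, h1, h2⟩ ⟨⟨μ', T'⟩, h1', h2'⟩ h
    have h := congrArg Subtype.val h
    simp only [f, Sigma.mk.injEq] at h
    obtain ⟨rfl, h⟩ := h
    have := std_inj μ w T T' h2 h2' (eq_of_heq h)
    subst this
    rfl
  have := Nat.card_le_card_of_injective f hf
  rwa [Nat.card_eq_fintype_card (α := G), Fintype.card_coe] at this
end

section
/- The maximum of the Edelman–Greene statistic EG(w) over all w ∈ S_∞ with Coxeter length n equals the number of involutions in S_n. -/
open Equiv

/-! ### Part A: two reduced words of the same permutation with the same relative order agree -/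

namespace EGProof

/-- Product of a word. -/
def P (l : List ℕ) : Equiv.Perm ℕ := (l.map EGs).prod

theorem P_nil : P [] = 1 := rfl
theorem P_cons (x : ℕ) (l : List ℕ) : P (x :: l) = EGs x * P l := by simp [P]

/-- The increasing map skipping `h`. -/
def iot (h x : ℕ) : ℕ := if x < h then x else x + 1

theorem iot_inj (h : ℕ) {x y : ℕ} (e : iot h x = iot h y) : x = y := by
  unfold iot at e; split_ifs at e <;> omega

theorem iot_surj (h : ℕ) {y : ℕ} (e : y ≠ h) : ∃ x, iot h x = y := by
  by_cases hy : y < h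
  · exact ⟨y, by simp [iot, hy]⟩
  · refine ⟨y - 1, ?_⟩
    unfold iot; split_ifs <;> omega

/-- Final height of the wire which sits at height `h` on the left. -/
def finH : ℕ → List ℕ → ℕ
  | h, [] => h
  | h, x :: l => if x = h then finH (h + 1) l else if x + 1 = h then finH x l else finH h l

/-- The word left when that wire is deleted. -/
def strip : ℕ → List ℕ → List ℕ
  | _, [] => []
  | h, x :: l => if x = h then strip (h + 1) l else if x + 1 = h then strip x l
      else (if x < h then x else x - 1) :: strip h l

/-- The wire never goes down. -/
def nobad : ℕ → List ℕ → Prop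
  | _, [] => True
  | h, x :: l => if x = h then nobad (h + 1) l else x + 1 ≠ h ∧ nobad h l

theorem EGs_apply (i x : ℕ) : EGs i x = if x = i then i + 1 else if x = i + 1 then i else x := by
  unfold EGs; rw [Equiv.swap_apply_def]

theorem P_fin (l : List ℕ) : ∀ h, P l (finH h l) = h := by
  induction l with
  | nil => intro h; simp [P, finH]
  | cons x l ih =>
    intro h
    rw [P_cons, Equiv.Perm.mul_apply]
    unfold finH
    split_ifs with h1 h2
    · rw [ih, EGs_apply]; split_ifs <;> omega
    · rw [ih, EGs_apply]; split_ifs <;> omega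
    · rw [ih, EGs_apply]; split_ifs <;> omega

theorem P_iot (l : List ℕ) : ∀ h y, P l (iot (finH h l) y) = iot h (P (strip h l) y) := by
  induction l with
  | nil => intro h y; simp [P, finH, strip]
  | cons x l ih =>
    intro h y
    rw [P_cons, Equiv.Perm.mul_apply]
    unfold finH strip
    split_ifs with h1 h2 h3
    · rw [ih]; generalize P (strip (h + 1) l) y = z
      rw [EGs_apply]; unfold iot; split_ifs <;> omega
    · rw [ih]; generalize P (strip x l) y = z
      rw [EGs_apply]; unfold iot; split_ifs <;> omega
    · rw [ih, P_cons, Equiv.Perm.mul_apply]; generalize P (strip h l) y = z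
      rw [EGs_apply, EGs_apply]; unfold iot; split_ifs <;> omega
    · rw [ih, P_cons, Equiv.Perm.mul_apply]; generalize P (strip h l) y = z
      rw [EGs_apply, EGs_apply]; unfold iot; split_ifs <;> omega

theorem strip_len (l : List ℕ) : ∀ h, (strip h l).length + finH h l ≤ l.length + h := by
  induction l with
  | nil => intro h; simp [strip, finH]
  | cons x l ih =>
    intro h
    unfold strip finH
    split_ifs with h1 h2 h3
    · have := ih (h + 1); simp only [List.length_cons]; omega
    · have := ih x; simp only [List.length_cons]; omega
    · have := ih h; simp only [List.length_cons]; omega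
    · have := ih h; simp only [List.length_cons]; omega

theorem strip_len_lt (l : List ℕ) : ∀ h, ¬ nobad h l →
    (strip h l).length + finH h l < l.length + h := by
  induction l with
  | nil => intro h hb; simp [nobad] at hb
  | cons x l ih =>
    intro h hb
    unfold nobad at hb
    unfold strip finH
    split_ifs at hb ⊢ with h1 h2 h3
    · have := ih (h + 1) hb; simp only [List.length_cons]; omega
    · have := strip_len l x; simp only [List.length_cons]; omega
    · have := ih h (fun hh => hb ⟨h2, hh⟩); simp only [List.length_cons]; omega
    · have := ih h (fun hh => hb ⟨h2, hh⟩); simp only [List.length_cons]; omega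

theorem strip_lift (q l : List ℕ) : strip 0 (l.map (· + 1) ++ q) = l ++ strip 0 q ∧
    finH 0 (l.map (· + 1) ++ q) = finH 0 q := by
  induction l with
  | nil => simp
  | cons x l ih => simp [strip, finH, ih]

theorem strip_range (k : ℕ) : ∀ h, strip h (List.range' h k) = [] ∧
    finH h (List.range' h k) = h + k := by
  induction k with
  | zero => intro h; simp [strip, finH]
  | succ k ih =>
    intro h; simp only [List.range'_succ, strip, finH, if_true, ih]
    exact ⟨trivial, by omega⟩

theorem P_determined {l m : List ℕ} (h1 : finH 0 l = finH 0 m)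
    (h2 : P (strip 0 l) = P (strip 0 m)) : P l = P m := by
  ext y
  by_cases hy : y = finH 0 l
  · subst hy; rw [P_fin, h1, P_fin]
  · obtain ⟨x, rfl⟩ := iot_surj _ hy
    rw [P_iot, h2, h1, P_iot]

theorem P_determines {l m : List ℕ} (h : P l = P m) :
    finH 0 l = finH 0 m ∧ P (strip 0 l) = P (strip 0 m) := by
  have h1 : finH 0 l = finH 0 m := by
    apply (P l).injective
    rw [P_fin, h, P_fin]
  refine ⟨h1, ?_⟩
  ext y
  apply iot_inj 0
  rw [← P_iot, ← P_iot, h, h1]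

/-- Minimal-length words. -/
def Red (l : List ℕ) : Prop := ∀ m, P m = P l → l.length ≤ m.length

theorem Red.aux {l : List ℕ} (hl : Red l) (m : List ℕ) (hm : P m = P (strip 0 l)) :
    l.length ≤ m.length + finH 0 l := by
  have key : P (m.map (· + 1) ++ List.range' 0 (finH 0 l)) = P l := by
    apply P_determined
    · rw [(strip_lift _ _).2, (strip_range _ _).2, zero_add]
    · rw [(strip_lift _ _).1, (strip_range _ _).1, List.append_nil, hm]
  simpa using hl _ key

theorem Red.nobad {l : List ℕ} (hl : Red l) : nobad 0 l := by
  by_contra hb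
  have h1 := strip_len_lt l 0 hb
  have h2 := hl.aux _ rfl
  omega

theorem Red.strip {l : List ℕ} (hl : Red l) : Red (strip 0 l) := by
  intro m hm
  have h1 := hl.aux m hm
  have h2 := strip_len l 0
  omega

/-- Weight for the induction. -/
def wt (l : List ℕ) : ℕ := l.sum + l.length

theorem wt_strip (l : List ℕ) : ∀ h, wt (strip h l) ≤ wt l := by
  induction l with
  | nil => intro h; simp [strip]
  | cons x l ih =>
    intro h
    unfold EGProof.strip
    have i1 := ih (h + 1)
    have i2 := ih x
    have i3 := ih h
    unfold wt at *
    split_ifs with h1 h2 h3 <;> simp only [List.sum_cons, List.length_cons] <;> omega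

theorem wt_strip_zero (x : ℕ) (l : List ℕ) : wt (strip 0 (x :: l)) < wt (x :: l) := by
  unfold EGProof.strip
  have i1 := wt_strip l (0 + 1)
  have i2 := wt_strip l x
  have i3 := wt_strip l 0
  unfold wt at *
  split_ifs with h1 h2 h3 <;> simp only [List.sum_cons, List.length_cons] <;> omega

/-- Same relative order. -/
def HR (p q : ℕ × ℕ) : Prop := p.1 < q.1 ↔ p.2 < q.2

theorem phase2 (L : List (ℕ × ℕ)) : ∀ α β : ℕ, L.Pairwise HR → β < α →
    nobad α (L.map Prod.fst) → nobad β (L.map Prod.snd) →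
    (∀ t ∈ L, α ≤ t.1 → α + 1 ≤ t.2) → (∀ t ∈ L, β ≤ t.2 → β ≤ t.1) →
    finH β (L.map Prod.snd) < finH α (L.map Prod.fst) := by
  induction L with
  | nil => intro α β _ h _ _ _ _; simpa [finH] using h
  | cons t L ih =>
    intro α β hp hlt na nb I1 I2
    obtain ⟨a, b⟩ := t
    rw [List.pairwise_cons] at hp
    obtain ⟨hh, hp⟩ := hp
    simp only [List.map_cons] at na nb ⊢
    simp only [List.mem_cons, forall_eq_or_imp] at I1 I2
    unfold EGProof.nobad at na nb
    unfold finH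
    by_cases ha : a = α
    · have hb : b ≠ β := by have := I1.1; omega
      simp only [ha, hb, if_true, if_false] at na nb ⊢
      rw [if_neg nb.1]
      apply ih _ _ hp (by omega) na nb.2
      · intro t ht hta
        have h3 := hh t ht
        unfold HR at h3
        have := I1.1
        try dsimp only at h3 this
        omega
      · exact I2.2
    · simp only [ha, if_false] at na ⊢
      rw [if_neg na.1]
      have c1 := I1.1
      have c2 := I2.1
      try dsimp only at c1 c2
      by_cases hb : b = β
      · simp only [hb, if_true] at nb ⊢
        apply ih _ _ hp (by omega) na.2 nb I1.2
        intro t ht hta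
        have h3 := hh t ht
        unfold HR at h3
        try dsimp only at h3
        omega
      · simp only [hb, if_false] at nb ⊢
        rw [if_neg nb.1]
        exact ih _ _ hp hlt na.2 nb.2 I1.2 I2.2

/-- Simultaneous deletion. -/
def zstrip : ℕ → List (ℕ × ℕ) → List (ℕ × ℕ)
  | _, [] => []
  | h, p :: l => if p.1 = h then zstrip (h + 1) l
      else (if p.1 < h then p else (p.1 - 1, p.2 - 1)) :: zstrip h l

/-- Both words follow the same path. -/
def common : ℕ → List (ℕ × ℕ) → Prop
  | _, [] => True
  | h, p :: l => if p.1 = h then p.2 = h ∧ common (h + 1) l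
      else p.1 + 1 ≠ h ∧ p.2 + 1 ≠ h ∧ p.2 ≠ h ∧ common h l

theorem pairwise_swap {L : List (ℕ × ℕ)} (h : L.Pairwise HR) :
    (L.map Prod.swap).Pairwise HR := by
  rw [List.pairwise_map]
  exact h.imp (fun h => by unfold HR at *; simpa using h.symm)

theorem phase1 (L : List (ℕ × ℕ)) : ∀ h : ℕ, L.Pairwise HR →
    nobad h (L.map Prod.fst) → nobad h (L.map Prod.snd) →
    (∀ t ∈ L, h ≤ t.1 ↔ h ≤ t.2) →
    finH h (L.map Prod.snd) = finH h (L.map Prod.fst) → common h L := by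
  induction L with
  | nil => intros; trivial
  | cons t L ih =>
    intro h hp na nb C he
    obtain ⟨a, b⟩ := t
    rw [List.pairwise_cons] at hp
    obtain ⟨hh, hp⟩ := hp
    simp only [List.map_cons] at na nb he
    simp only [List.mem_cons, forall_eq_or_imp] at C
    obtain ⟨C0, C⟩ := C
    unfold EGProof.nobad at na nb
    unfold finH at he
    unfold common
    by_cases ha : a = h
    · by_cases hb : b = h
      · subst hb
        simp only [ha, if_true] at na nb he ⊢
        refine ⟨trivial, ih _ hp na nb ?_ he⟩
        intro t ht
        have h3 := hh t ht
        unfold HR at h3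
        try dsimp only at h3
        omega
      · exfalso
        simp only [ha, hb, if_true, if_false] at na nb he
        rw [if_neg nb.1] at he
        refine absurd he (ne_of_lt (phase2 L (h + 1) h hp (by omega) na nb.2 ?_ ?_))
        · intro t ht h4
          have h3 := hh t ht
          unfold HR at h3
          try dsimp only at h3
          omega
        · intro t ht h4
          exact (C t ht).2 h4
    · by_cases hb : b = h
      · exfalso
        simp only [ha, hb, if_true, if_false] at na nb he
        rw [if_neg na.1] at he
        have := phase2 (L.map Prod.swap) (h + 1) h (pairwise_swap hp) (by omega)
          (by simpa [List.map_map, Function.comp_def] using nb)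
          (by simpa [List.map_map, Function.comp_def] using na.2) ?_ ?_
        · simp only [List.map_map, Function.comp_def, Prod.fst_swap, Prod.snd_swap] at this
          have e1 : L.map (fun x => x.1) = L.map Prod.fst := rfl
          have e2 : L.map (fun x => x.2) = L.map Prod.snd := rfl
          rw [e1, e2] at this
          omega
        · intro t ht h4
          rw [List.mem_map] at ht
          obtain ⟨t, ht, rfl⟩ := ht
          have h3 := hh t ht
          unfold HR at h3
          simp only [Prod.fst_swap, Prod.snd_swap] at h3 h4 ⊢
          omega
        · intro t ht h4
          rw [List.mem_map] at ht
          obtain ⟨t, ht, rfl⟩ := ht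
          simp only [Prod.fst_swap, Prod.snd_swap] at h4 ⊢
          exact (C t ht).1 h4
      · simp only [ha, hb, if_false] at na nb he ⊢
        rw [if_neg nb.1, if_neg na.1] at he
        exact ⟨na.1, nb.1, hb, ih _ hp na.2 nb.2 C he⟩

theorem zstrip_fst (L : List (ℕ × ℕ)) : ∀ h, common h L →
    (zstrip h L).map Prod.fst = strip h (L.map Prod.fst) := by
  induction L with
  | nil => intros; rfl
  | cons t L ih =>
    intro h hc
    obtain ⟨a, b⟩ := t
    unfold common at hc
    unfold zstrip
    simp only [List.map_cons]
    unfold EGProof.strip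
    by_cases ha : a = h
    · simp only [ha, if_true] at hc ⊢
      exact ih _ hc.2
    · simp only [ha, if_false] at hc ⊢
      rw [if_neg hc.1, List.map_cons, ih _ hc.2.2.2]
      split_ifs <;> rfl

theorem zstrip_snd (L : List (ℕ × ℕ)) : ∀ h, common h L → L.Pairwise HR →
    (∀ t ∈ L, h ≤ t.1 ↔ h ≤ t.2) →
    (zstrip h L).map Prod.snd = strip h (L.map Prod.snd) := by
  induction L with
  | nil => intros; rfl
  | cons t L ih =>
    intro h hc hp C
    obtain ⟨a, b⟩ := t
    rw [List.pairwise_cons] at hp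
    obtain ⟨hh, hp⟩ := hp
    simp only [List.mem_cons, forall_eq_or_imp] at C
    obtain ⟨C0, C⟩ := C
    unfold common at hc
    unfold zstrip
    simp only [List.map_cons]
    unfold EGProof.strip
    by_cases ha : a = h
    · simp only [ha, if_true] at hc ⊢
      rw [if_pos hc.1]
      refine ih _ hc.2 hp ?_
      intro t ht
      have h3 := hh t ht
      unfold HR at h3
      try dsimp only at h3
      omega
    · simp only [ha, if_false] at hc ⊢
      rw [if_neg hc.2.1, if_neg hc.2.2.1, List.map_cons, ih _ hc.2.2.2 hp C]
      try dsimp only at C0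
      split_ifs <;> first | rfl | omega

theorem zstrip_diag (L : List (ℕ × ℕ)) : ∀ h, common h L → L.Pairwise HR →
    (∀ t ∈ L, h ≤ t.1 ↔ h ≤ t.2) →
    (∀ t ∈ zstrip h L, t.1 = t.2) → ∀ t ∈ L, t.1 = t.2 := by
  induction L with
  | nil => intro h _ _ _ _ t ht; simp at ht
  | cons t L ih =>
    intro h hc hp C hd
    obtain ⟨a, b⟩ := t
    rw [List.pairwise_cons] at hp
    obtain ⟨hh, hp⟩ := hp
    simp only [List.mem_cons, forall_eq_or_imp] at C ⊢
    obtain ⟨C0, C⟩ := C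
    unfold common at hc
    unfold zstrip at hd
    by_cases ha : a = h
    · simp only [ha, if_true] at hc hd ⊢
      refine ⟨hc.1.symm, ih _ hc.2 hp ?_ hd⟩
      intro t ht
      have h3 := hh t ht
      unfold HR at h3
      try dsimp only at h3
      omega
    · simp only [ha, if_false, List.mem_cons, forall_eq_or_imp] at hc hd ⊢
      refine ⟨?_, ih _ hc.2.2.2 hp C hd.2⟩
      have h5 := hd.1
      try dsimp only at C0
      split_ifs at h5 <;> simp only at h5 <;> omega

/-- An element below the wire keeps its relation to later ones. -/
theorem rel_below (L : List (ℕ × ℕ)) (x y : ℕ) : ∀ h, common h L → L.Pairwise HR →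
    (∀ t ∈ L, h ≤ t.1 ↔ h ≤ t.2) → x < h → y < h → (∀ t ∈ L, HR (x, y) t) →
    ∀ t ∈ zstrip h L, HR (x, y) t := by
  induction L with
  | nil => intro h _ _ _ _ _ _ t ht; simp [zstrip] at ht
  | cons t L ih =>
    intro h hc hp C hx hy hr
    obtain ⟨a, b⟩ := t
    rw [List.pairwise_cons] at hp
    obtain ⟨hh, hp⟩ := hp
    simp only [List.mem_cons, forall_eq_or_imp] at C hr
    obtain ⟨C0, C⟩ := C
    unfold common at hc
    unfold zstrip
    by_cases ha : a = h
    · simp only [ha, if_true] at hc ⊢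
      refine ih _ hc.2 hp ?_ (by omega) (by omega) hr.2
      intro t ht
      have h3 := hh t ht
      unfold HR at h3
      try dsimp only at h3
      omega
    · simp only [ha, if_false, List.mem_cons, forall_eq_or_imp] at hc ⊢
      refine ⟨?_, ih _ hc.2.2.2 hp C hx hy hr.2⟩
      have h6 := hr.1
      unfold HR at h6 ⊢
      try dsimp only at C0 h6
      split_ifs <;> simp only <;> omega

/-- An element above the wire, after decrement, keeps its relation to later ones. -/
theorem rel_above (L : List (ℕ × ℕ)) (x y h0 : ℕ) (hx0 : h0 ≤ x) (hy0 : h0 ≤ y) :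
    ∀ h, common h L → L.Pairwise HR → h0 ≤ h →
    (∀ c, h0 ≤ c → c ≤ h → ∀ t ∈ L, c ≤ t.1 ↔ c ≤ t.2) →
    ((h ≤ x + 2 ∧ h ≤ y + 2) ∨ (x = y ∧ x + 2 ≤ h)) → (∀ t ∈ L, HR (x + 1, y + 1) t) →
    ∀ t ∈ zstrip h L, HR (x, y) t := by
  induction L with
  | nil => intro h _ _ _ _ _ _ t ht; simp [zstrip] at ht
  | cons t L ih =>
    intro h hc hp hle C hs hr
    obtain ⟨a, b⟩ := t
    rw [List.pairwise_cons] at hp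
    obtain ⟨hh, hp⟩ := hp
    simp only [List.mem_cons, forall_eq_or_imp] at C hr
    unfold common at hc
    unfold zstrip
    have h6 := hr.1
    unfold HR at h6
    try dsimp only at h6
    by_cases ha : a = h
    · simp only [ha, if_true] at hc ⊢
      refine ih _ hc.2 hp (by omega) ?_ ?_ hr.2
      · intro c hc1 hc2 t ht
        rcases Nat.lt_or_ge h c with h7 | h7
        · have h3 := hh t ht
          unfold HR at h3
          try dsimp only at h3
          omega
        · exact (C c hc1 h7).2 t ht
      · omega
    · simp only [ha, if_false, List.mem_cons, forall_eq_or_imp] at hc ⊢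
      refine ⟨?_, ih _ hc.2.2.2 hp hle (fun c h1 h2 => (C c h1 h2).2) hs hr.2⟩
      have C0 := (C h hle le_rfl).1
      unfold HR
      try dsimp only at C0
      rcases hs with hs | hs
      · split_ifs <;> simp only <;> omega
      · have C1 := (C (x + 1) (by omega) (by omega)).1
        try dsimp only at C1
        split_ifs <;> simp only <;> omega

theorem zstrip_pairwise (L : List (ℕ × ℕ)) : ∀ h, common h L → L.Pairwise HR →
    (∀ t ∈ L, h ≤ t.1 ↔ h ≤ t.2) → (zstrip h L).Pairwise HR := by
  induction L with
  | nil => intros; exact List.Pairwise.nil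
  | cons t L ih =>
    intro h hc hp C
    obtain ⟨a, b⟩ := t
    rw [List.pairwise_cons] at hp
    obtain ⟨hh, hp⟩ := hp
    simp only [List.mem_cons, forall_eq_or_imp] at C
    obtain ⟨C0, C⟩ := C
    unfold common at hc
    unfold zstrip
    by_cases ha : a = h
    · simp only [ha, if_true] at hc ⊢
      refine ih _ hc.2 hp ?_
      intro t ht
      have h3 := hh t ht
      unfold HR at h3
      try dsimp only at h3
      omega
    · simp only [ha, if_false] at hc ⊢
      try dsimp only at C0
      rw [List.pairwise_cons]
      refine ⟨?_, ih _ hc.2.2.2 hp C⟩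
      split_ifs with hah
      · exact rel_below L a b h hc.2.2.2 hp C hah (by omega) hh
      · refine rel_above L (a - 1) (b - 1) h (by omega) (by omega) h hc.2.2.2 hp le_rfl ?_
          (by omega) ?_
        · intro c h1 h2
          obtain rfl : c = h := by omega
          exact C
        · have e1 : a - 1 + 1 = a := by omega
          have e2 : b - 1 + 1 = b := by omega
          rw [e1, e2]; exact hh

theorem words_eq (N : ℕ) : ∀ L : List (ℕ × ℕ), wt (L.map Prod.fst) ≤ N → L.Pairwise HR →
    Red (L.map Prod.fst) → Red (L.map Prod.snd) →
    P (L.map Prod.fst) = P (L.map Prod.snd) → ∀ t ∈ L, t.1 = t.2 := by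
  induction N with
  | zero =>
    intro L hN
    cases L with
    | nil => intro _ _ _ _ t ht; simp at ht
    | cons p L => simp [wt] at hN
  | succ N ih =>
    intro L hN hp ra rb he
    cases L with
    | nil => intro t ht; simp at ht
    | cons p L =>
      obtain ⟨d1, d2⟩ := P_determines he
      have C : ∀ t ∈ p :: L, 0 ≤ t.1 ↔ 0 ≤ t.2 := by intro t _; simp
      have hc := phase1 (p :: L) 0 hp ra.nobad rb.nobad C d1.symm
      have e1 := zstrip_fst _ _ hc
      have e2 := zstrip_snd _ _ hc hp C
      apply zstrip_diag _ 0 hc hp C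
      apply ih
      · rw [e1]
        have := wt_strip_zero p.1 (L.map Prod.fst)
        simp only [List.map_cons] at hN ⊢
        omega
      · exact zstrip_pairwise _ _ hc hp C
      · rw [e1]; exact ra.strip
      · rw [e2]; exact rb.strip
      · rw [e1, e2]; exact d2

theorem red_of_isReducedWord {w : Equiv.Perm ℕ} {l : List ℕ} (h : IsReducedWord w l) :
    P l = w ∧ Red l := by
  refine ⟨h.1, ?_⟩
  intro m hm
  rw [h.2]
  apply Nat.sInf_le
  exact ⟨m, hm.trans h.1, rfl⟩

end EGProof

/-! ### Part B: standardization and the extremal permutation -/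

namespace EGProof

/-- Cells in reading order. -/
def readCells (μ : YoungDiagram) : List (ℕ × ℕ) :=
  (List.range (μ.colLen 0)).flatMap fun i =>
    ((List.range (μ.rowLen i)).reverse).map fun j => (i, j)

theorem readingWord_eq (μ : YoungDiagram) (T : ℕ → ℕ → ℕ) :
    readingWord μ T = (readCells μ).map fun c => T c.1 c.2 := by
  simp [readingWord, readCells, List.map_flatMap, List.map_map, Function.comp_def]

theorem mem_readCells (μ : YoungDiagram) (c : ℕ × ℕ) : c ∈ readCells μ ↔ c ∈ μ.cells := by
  obtain ⟨i, j⟩ := c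
  simp only [readCells, List.mem_flatMap, List.mem_range, List.mem_map, List.mem_reverse,
    Prod.mk.injEq, YoungDiagram.mem_cells]
  constructor
  · rintro ⟨i', _, j', h, rfl, rfl⟩
    exact YoungDiagram.mem_iff_lt_rowLen.2 h
  · intro h
    refine ⟨i, ?_, j, YoungDiagram.mem_iff_lt_rowLen.1 h, rfl, rfl⟩
    apply YoungDiagram.mem_iff_lt_colLen.1
    exact μ.up_left_mem le_rfl (Nat.zero_le _) h

/-- Reading order. -/
def before (c d : ℕ × ℕ) : Prop := c.1 < d.1 ∨ (c.1 = d.1 ∧ d.2 < c.2)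

theorem readCells_pairwise (μ : YoungDiagram) : (readCells μ).Pairwise before := by
  unfold readCells
  rw [List.pairwise_flatMap]
  constructor
  · intro i _
    rw [List.pairwise_map, List.pairwise_reverse]
    exact List.pairwise_lt_range.imp (fun h => Or.inr ⟨rfl, h⟩)
  · refine List.pairwise_lt_range.imp ?_
    intro i i' h c hc d hd
    simp only [List.mem_map] at hc hd
    obtain ⟨_, _, rfl⟩ := hc
    obtain ⟨_, _, rfl⟩ := hd
    exact Or.inl h

theorem readCells_nodup (μ : YoungDiagram) : (readCells μ).Nodup := by
  refine (readCells_pairwise μ).imp ?_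
  intro c d h
  rintro rfl
  rcases h with h | h <;> omega

theorem readCells_length (μ : YoungDiagram) : (readCells μ).length = μ.card := by
  rw [← List.toFinset_card_of_nodup (readCells_nodup μ)]
  congr 1
  ext c; simp [mem_readCells]

/-- Comparison of cells: by entry, then by column, then by row. -/
def cle (T : ℕ → ℕ → ℕ) (c d : ℕ × ℕ) : Prop :=
  T c.1 c.2 < T d.1 d.2 ∨ (T c.1 c.2 = T d.1 d.2 ∧ c.2 < d.2) ∨
    (T c.1 c.2 = T d.1 d.2 ∧ c.2 = d.2 ∧ c.1 ≤ d.1)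

theorem cle_total (T : ℕ → ℕ → ℕ) (c d : ℕ × ℕ) : cle T c d ∨ cle T d c := by
  unfold cle; omega

theorem cle_trans {T : ℕ → ℕ → ℕ} {c d e : ℕ × ℕ} (h : cle T c d) (h' : cle T d e) :
    cle T c e := by
  unfold cle at *; omega

theorem std_of_mem {μ : YoungDiagram} {T : ℕ → ℕ → ℕ} {c : ℕ × ℕ} (h : c ∈ μ.cells) :
    stdEntry μ T c.1 c.2 = (μ.cells.filter fun d =>
      T d.1 d.2 < T c.1 c.2 ∨ (T d.1 d.2 = T c.1 c.2 ∧ d.2 < c.2) ∨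
        (T d.1 d.2 = T c.1 c.2 ∧ d.2 = c.2 ∧ d.1 ≤ c.1)).card := by
  unfold stdEntry
  rw [if_pos h]

theorem std_lt {μ : YoungDiagram} {T : ℕ → ℕ → ℕ} {c d : ℕ × ℕ} (hc : c ∈ μ.cells)
    (hd : d ∈ μ.cells) (h : ¬ cle T d c) : stdEntry μ T c.1 c.2 < stdEntry μ T d.1 d.2 := by
  rw [std_of_mem hc, std_of_mem hd]
  apply Finset.card_lt_card
  rw [Finset.ssubset_iff_of_subset]
  · refine ⟨d, ?_, ?_⟩
    · simp [hd]
    · simp only [Finset.mem_filter, not_and]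
      intro _; exact h
  · intro e he
    simp only [Finset.mem_filter] at he ⊢
    exact ⟨he.1, cle_trans (T := T) (d := c) he.2 ((cle_total T c d).resolve_right h)⟩

theorem std_mem {μ : YoungDiagram} {w : Equiv.Perm ℕ} {T : ℕ → ℕ → ℕ} (hT : T ∈ EGset μ w) :
    stdEntry μ T ∈ SYTset μ := by
  obtain ⟨h1, h2, h3, _⟩ := hT
  have hinj : Set.InjOn (fun c : ℕ × ℕ => stdEntry μ T c.1 c.2) (μ.cells : Set (ℕ × ℕ)) := by
    intro c hc d hd hcd
    by_contra hne
    rcases cle_total T c d with h | h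
    · have : ¬ cle T d c := by
        intro h'; apply hne; unfold cle at h h'; ext <;> omega
      exact absurd hcd (std_lt hc hd this).ne
    · have : ¬ cle T c d := by
        intro h'; apply hne; unfold cle at h h'; ext <;> omega
      exact absurd hcd (std_lt hd hc this).ne'
  refine ⟨?_, ?_, ?_, ?_⟩
  · intro i j1 j2 hj hm
    have hm1 : (i, j1) ∈ μ.cells := by
      rw [YoungDiagram.mem_cells] at *; exact μ.up_left_mem le_rfl hj.le hm
    have := h1 i j1 j2 hj hm
    exact std_lt (c := (i, j1)) (d := (i, j2)) hm1 hm (by unfold cle; dsimp only; omega)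
  · intro i1 i2 j hi hm
    have hm1 : (i1, j) ∈ μ.cells := by
      rw [YoungDiagram.mem_cells] at *; exact μ.up_left_mem hi.le le_rfl hm
    have := h2 i1 i2 j hi hm
    exact std_lt (c := (i1, j)) (d := (i2, j)) hm1 hm (by unfold cle; dsimp only; omega)
  · intro i j hm
    unfold stdEntry
    rw [if_neg hm]
  · apply Finset.eq_of_subset_of_card_le
    · intro k hk
      rw [Finset.mem_image] at hk
      obtain ⟨c, hc, rfl⟩ := hk
      rw [Finset.mem_Icc, std_of_mem hc]
      constructor
      · apply Finset.card_pos.2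
        exact ⟨c, Finset.mem_filter.2 ⟨hc, Or.inr (Or.inr ⟨rfl, rfl, le_rfl⟩)⟩⟩
      · exact Finset.card_le_card (Finset.filter_subset _ _)
    · rw [Finset.card_image_of_injOn hinj]
      simp [YoungDiagram.card]

/-- For cells in reading order, the standardization knows the relative order. -/
theorem std_rel {μ : YoungDiagram} {w : Equiv.Perm ℕ} {T : ℕ → ℕ → ℕ} (hT : T ∈ EGset μ w)
    {c d : ℕ × ℕ} (hc : c ∈ μ.cells) (hd : d ∈ μ.cells) (hb : before c d) :
    T c.1 c.2 < T d.1 d.2 ↔ stdEntry μ T c.1 c.2 < stdEntry μ T d.1 d.2 := by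
  constructor
  · intro h
    exact std_lt hc hd (by unfold cle; omega)
  · intro h
    by_contra hge
    have : ¬ cle T c d := by
      intro hcd
      obtain ⟨i, j⟩ := c
      obtain ⟨i', j'⟩ := d
      unfold cle at hcd
      unfold before at hb
      dsimp only at *
      have e : T i j = T i' j' := by omega
      have hj : j ≤ j' := by omega
      have hi : i < i' := by omega
      have hm : (i, j') ∈ μ.cells := by
        rw [YoungDiagram.mem_cells] at *; exact μ.up_left_mem hi.le le_rfl hd
      have h2 := hT.2.1 i i' j' hi hd
      rcases hj.lt_or_eq with hj | hj
      · have h1 := hT.1 i j j' hj hm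
        omega
      · subst hj; omega
    have := std_lt hd hc this
    omega

theorem std_injective {μ : YoungDiagram} {w : Equiv.Perm ℕ} {T T' : ℕ → ℕ → ℕ}
    (hT : T ∈ EGset μ w) (hT' : T' ∈ EGset μ w) (h : stdEntry μ T = stdEntry μ T') : T = T' := by
  have r1 := hT.2.2.2
  have r2 := hT'.2.2.2
  rw [readingWord_eq] at r1 r2
  obtain ⟨p1, r1⟩ := red_of_isReducedWord r1
  obtain ⟨p2, r2⟩ := red_of_isReducedWord r2
  have key := words_eq _ ((readCells μ).map fun c => (T c.1 c.2, T' c.1 c.2)) le_rfl ?_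
    (by simpa [List.map_map, Function.comp_def] using r1)
    (by simpa [List.map_map, Function.comp_def] using r2)
    (by simp only [List.map_map, Function.comp_def]; rw [p1, p2])
  · funext i j
    by_cases hm : (i, j) ∈ μ.cells
    · exact key (T i j, T' i j) (List.mem_map.2 ⟨(i, j), (mem_readCells _ _).2 hm, rfl⟩)
    · rw [hT.2.2.1 i j hm, hT'.2.2.1 i j hm]
  · rw [List.pairwise_map]
    refine (readCells_pairwise μ).imp_of_mem ?_
    intro c d hc hd hb
    rw [mem_readCells] at hc hd
    unfold HR
    dsimp only
    rw [std_rel hT hc hd hb, std_rel hT' hc hd hb, h]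

/-- Pairs (shape, standard tableau) of size `n`. -/
abbrev SYTn (n : ℕ) : Type :=
  {p : YoungDiagram × (ℕ → ℕ → ℕ) // p.1.card = n ∧ p.2 ∈ SYTset p.1}

/-- Pairs (shape, EG tableau) of size `n`. -/
abbrev EGn (n : ℕ) (w : Equiv.Perm ℕ) : Type :=
  {p : YoungDiagram × (ℕ → ℕ → ℕ) // p.1.card = n ∧ p.2 ∈ EGset p.1 w}

theorem exists_inj_EG (n : ℕ) (w : Equiv.Perm ℕ) :
    ∃ f : EGn n w → SYTn n, Function.Injective f := by
  refine ⟨fun p => ⟨(p.1.1, stdEntry p.1.1 p.1.2), p.2.1, std_mem p.2.2⟩, ?_⟩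
  rintro ⟨⟨μ, T⟩, h1, h2⟩ ⟨⟨μ', T'⟩, h1', h2'⟩ h
  simp only [Subtype.mk.injEq, Prod.mk.injEq] at h h2 h2' ⊢
  obtain ⟨rfl, h⟩ := h
  exact ⟨rfl, std_injective h2 h2' h⟩

/-! The extremal permutation. -/

/-- Letters pairwise at distance at least two. -/
def far (a b : ℕ) : Prop := a + 2 ≤ b ∨ b + 2 ≤ a

theorem P_fix (l : List ℕ) (k : ℕ) (h : ∀ x ∈ l, x ≠ k ∧ x + 1 ≠ k) : P l k = k := by
  induction l with
  | nil => rfl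
  | cons x l ih =>
    simp only [List.mem_cons, forall_eq_or_imp] at h
    rw [P_cons, Equiv.Perm.mul_apply, ih h.2, EGs_apply]
    split_ifs <;> omega

theorem P_far (l : List ℕ) (k : ℕ) (h : l.Pairwise far) (hk : k ∈ l) : P l k = k + 1 := by
  induction l with
  | nil => simp at hk
  | cons x l ih =>
    rw [List.pairwise_cons] at h
    rw [P_cons, Equiv.Perm.mul_apply]
    by_cases hx : x = k
    · subst hx
      rw [P_fix, EGs_apply]
      · simp
      · intro y hy
        have := h.1 y hy
        unfold far at this
        omega
    · have hk' : k ∈ l := by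
        rcases List.mem_cons.1 hk with h' | h'
        · exact absurd h'.symm hx
        · exact h'
      rw [ih h.2 hk', EGs_apply]
      have := h.1 k hk'
      unfold far at this
      split_ifs <;> omega

theorem P_stable (l : List ℕ) (k : ℕ) (hk : k ∉ l) (x : ℕ) (hx : x ≤ k) : P l x ≤ k := by
  induction l with
  | nil => exact hx
  | cons y l ih =>
    simp only [List.mem_cons, not_or] at hk
    rw [P_cons, Equiv.Perm.mul_apply, EGs_apply]
    have := ih hk.2
    split_ifs <;> omega

theorem far_reduced (l : List ℕ) (h : l.Pairwise far) : IsReducedWord (P l) l := by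
  refine ⟨rfl, ?_⟩
  have hnd : l.Nodup := h.imp (fun {a b} hab => by
    unfold far at hab
    rintro rfl
    omega)
  apply le_antisymm
  · unfold coxLength
    apply le_csInf
    · exact ⟨_, l, rfl, rfl⟩
    · rintro k ⟨m, hm, rfl⟩
      rw [← List.toFinset_card_of_nodup hnd]
      refine le_trans (Finset.card_le_card ?_) (List.toFinset_card_le m)
      intro x hx
      rw [List.mem_toFinset] at hx ⊢
      by_contra hxm
      have h1 := P_stable m x hxm x le_rfl
      have h2 := P_far l x h hx
      have h3 : P m = P l := hm
      rw [h3, h2] at h1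
      omega
  · exact Nat.sInf_le ⟨l, rfl, rfl⟩

theorem EGs_commute {a b : ℕ} (h : far a b) : EGs a * EGs b = EGs b * EGs a := by
  unfold far at h
  ext x
  simp only [Equiv.Perm.mul_apply, EGs_apply]
  split_ifs <;> omega

theorem P_perm {l m : List ℕ} (hp : l.Perm m) (h : l.Pairwise far) : P l = P m := by
  unfold P
  apply List.Perm.prod_eq' (hp.map _)
  rw [List.pairwise_map]
  exact h.imp (fun h => EGs_commute h)

/-- The extremal word. -/
def l0 (n : ℕ) : List ℕ := (List.range n).map (2 * ·)

theorem l0_far (n : ℕ) : (l0 n).Pairwise far := by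
  unfold l0
  rw [List.pairwise_map]
  refine List.pairwise_lt_range.imp ?_
  intro a b h
  unfold far
  omega

theorem l0_mem (n x : ℕ) : x ∈ l0 n ↔ ∃ k < n, 2 * k = x := by
  simp [l0]

theorem syt_bounds {μ : YoungDiagram} {U : ℕ → ℕ → ℕ} (hU : U ∈ SYTset μ) {i j : ℕ}
    (h : (i, j) ∈ μ.cells) : 1 ≤ U i j ∧ U i j ≤ μ.card := by
  have : U i j ∈ μ.cells.image (fun c => U c.1 c.2) := Finset.mem_image.2 ⟨(i, j), h, rfl⟩
  rw [hU.2.2.2] at this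
  exact Finset.mem_Icc.1 this

theorem syt_injOn {μ : YoungDiagram} {U : ℕ → ℕ → ℕ} (hU : U ∈ SYTset μ) :
    Set.InjOn (fun c : ℕ × ℕ => U c.1 c.2) (μ.cells : Set (ℕ × ℕ)) := by
  rw [← Finset.card_image_iff, hU.2.2.2]
  simp [YoungDiagram.card]

theorem dbl_mem {μ : YoungDiagram} {U : ℕ → ℕ → ℕ} (hU : U ∈ SYTset μ) :
    (fun i j => 2 * (U i j - 1)) ∈ EGset μ (P (l0 μ.card)) := by
  have hw : (readingWord μ (fun i j => 2 * (U i j - 1))).Perm (l0 μ.card) := by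
    rw [readingWord_eq]
    rw [List.perm_ext_iff_of_nodup]
    · intro x
      rw [l0_mem, List.mem_map]
      constructor
      · rintro ⟨c, hc, rfl⟩
        rw [mem_readCells] at hc
        have := syt_bounds hU hc
        exact ⟨U c.1 c.2 - 1, by omega, rfl⟩
      · rintro ⟨k, hk, rfl⟩
        have : k + 1 ∈ μ.cells.image (fun c => U c.1 c.2) := by
          rw [hU.2.2.2, Finset.mem_Icc]; omega
        obtain ⟨c, hc, h⟩ := Finset.mem_image.1 this
        exact ⟨c, (mem_readCells _ _).2 hc, by have h2 : U c.1 c.2 = k + 1 := h; show 2 * (U c.1 c.2 - 1) = 2 * k; omega⟩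
    · apply List.Nodup.map_on _ (readCells_nodup μ)
      intro c hc d hd h
      rw [mem_readCells] at hc hd
      apply syt_injOn hU hc hd
      have h1 := syt_bounds hU hc
      have h2 := syt_bounds hU hd
      dsimp only at *
      omega
    · exact (l0_far _).imp (fun {a b} hab => by
        unfold far at hab
        rintro rfl
        omega)
  have hf : (readingWord μ (fun i j => 2 * (U i j - 1))).Pairwise far :=
    (hw.symm.pairwise_iff (fun {a b} h => by unfold far at *; omega)).1 (l0_far _)
  refine ⟨?_, ?_, ?_, ?_⟩
  · intro i j1 j2 hj hm
    have hm1 : (i, j1) ∈ μ.cells := by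
      rw [YoungDiagram.mem_cells] at *; exact μ.up_left_mem le_rfl hj.le hm
    have := hU.1 i j1 j2 hj hm
    have := syt_bounds hU hm1
    dsimp only
    omega
  · intro i1 i2 j hi hm
    have hm1 : (i1, j) ∈ μ.cells := by
      rw [YoungDiagram.mem_cells] at *; exact μ.up_left_mem hi.le le_rfl hm
    have := hU.2.1 i1 i2 j hi hm
    have := syt_bounds hU hm1
    dsimp only
    omega
  · intro i j hm
    have := hU.2.2.1 i j hm
    dsimp only
    omega
  · rw [← P_perm hw hf]
    exact far_reduced _ hf

theorem exists_inj_SYT (n : ℕ) :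
    ∃ f : SYTn n → EGn n (P (l0 n)), Function.Injective f := by
  refine ⟨fun p => ⟨(p.1.1, fun i j => 2 * (p.1.2 i j - 1)), p.2.1, ?_⟩, ?_⟩
  · have := dbl_mem p.2.2
    rw [p.2.1] at this
    exact this
  · rintro ⟨⟨μ, U⟩, h1, h2⟩ ⟨⟨μ', U'⟩, h1', h2'⟩ h
    simp only [Subtype.mk.injEq, Prod.mk.injEq] at h h2 h2' ⊢
    obtain ⟨rfl, h⟩ := h
    refine ⟨rfl, ?_⟩
    funext i j
    by_cases hm : (i, j) ∈ μ.cells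
    · have e := congrFun (congrFun h i) j
      have b1 := syt_bounds h2 hm
      have b2 := syt_bounds h2' hm
      omega
    · rw [h2.2.2.1 i j hm, h2'.2.2.1 i j hm]

theorem reduce_to_count (n : ℕ) (c : ℕ) (hc : Nat.card (SYTn n) = c) (hpos : 0 < c) :
    IsGreatest
      {m : ℕ | ∃ w : Equiv.Perm ℕ, (∃ l : List ℕ, IsReducedWord w l ∧ l.length = n) ∧
        m = Nat.card
          {p : YoungDiagram × (ℕ → ℕ → ℕ) // p.1.card = n ∧ p.2 ∈ EGset p.1 w}} c := by
  have hfin : Finite (SYTn n) := Nat.finite_of_card_ne_zero (by omega)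
  constructor
  · refine ⟨P (l0 n), ⟨l0 n, far_reduced _ (l0_far n), by simp [l0]⟩, ?_⟩
    obtain ⟨f, hf⟩ := exists_inj_EG n (P (l0 n))
    obtain ⟨g, hg⟩ := exists_inj_SYT n
    have hfin' : Finite (EGn n (P (l0 n))) := Finite.of_injective f hf
    rw [← hc]
    exact le_antisymm (Nat.card_le_card_of_injective g hg) (Nat.card_le_card_of_injective f hf)
  · rintro m ⟨w, _, rfl⟩
    obtain ⟨f, hf⟩ := exists_inj_EG n w
    rw [← hc]
    exact Nat.card_le_card_of_injective f hf

end EGProof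
namespace EGProof

theorem yd_finite (n : ℕ) : {μ : YoungDiagram | μ.card = n}.Finite := by
  have h : {μ : YoungDiagram | μ.card = n} ⊆
      (fun μ : YoungDiagram => μ.cells) ⁻¹'
        (((Finset.range n ×ˢ Finset.range n).powerset : Finset (Finset (ℕ × ℕ))) :
          Set (Finset (ℕ × ℕ))) := by
    intro μ hμ
    simp only [Set.mem_ofPred_eq] at hμ
    simp only [Set.mem_preimage, Finset.mem_coe, Finset.mem_powerset]
    rintro ⟨i, j⟩ hc
    rw [Finset.mem_product, Finset.mem_range, Finset.mem_range, ← hμ]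
    constructor
    · have : (Finset.range (i + 1)).image (fun k => (k, j)) ⊆ μ.cells := by
        intro c hc2
        obtain ⟨k, hk, rfl⟩ := Finset.mem_image.1 hc2
        exact μ.up_left_mem (by simpa [Nat.lt_succ_iff] using hk) le_rfl hc
      have h2 := Finset.card_le_card this
      rw [Finset.card_image_of_injective _ (fun a b h => (Prod.mk.inj h).1)] at h2
      simpa using h2
    · have : (Finset.range (j + 1)).image (fun k => (i, k)) ⊆ μ.cells := by
        intro c hc2
        obtain ⟨k, hk, rfl⟩ := Finset.mem_image.1 hc2
        exact μ.up_left_mem le_rfl (by simpa [Nat.lt_succ_iff] using hk) hc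
      have h2 := Finset.card_le_card this
      rw [Finset.card_image_of_injective _ (fun a b h => (Prod.mk.inj h).2)] at h2
      simpa using h2
  refine Set.Finite.subset (Set.Finite.preimage ?_ (Finset.finite_toSet _)) h
  intro a _ b _ hab
  exact YoungDiagram.ext hab

/-- Young diagrams with `n` cells. -/
noncomputable def Y (n : ℕ) : Finset YoungDiagram := (yd_finite n).toFinset

theorem mem_Y {n : ℕ} {μ : YoungDiagram} : μ ∈ Y n ↔ μ.card = n := by
  simp [Y]

open scoped Classical in
/-- Diagrams covering `μ`. -/
noncomputable def ups (μ : YoungDiagram) : Finset YoungDiagram :=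
  (Y (μ.card + 1)).filter fun l => μ ≤ l

open scoped Classical in
/-- Diagrams covered by `μ`. -/
noncomputable def downs (μ : YoungDiagram) : Finset YoungDiagram :=
  (Y (μ.card - 1)).filter fun k => k ≤ μ ∧ k.card + 1 = μ.card

theorem mem_ups {μ l : YoungDiagram} : l ∈ ups μ ↔ μ ≤ l ∧ l.card = μ.card + 1 := by
  simp only [ups, Finset.mem_filter, mem_Y]; tauto

theorem mem_downs {μ k : YoungDiagram} : k ∈ downs μ ↔ k ≤ μ ∧ k.card + 1 = μ.card := by
  simp only [downs, Finset.mem_filter, mem_Y]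
  constructor
  · tauto
  · intro h; exact ⟨by omega, h⟩

theorem card_le_of_le {μ ν : YoungDiagram} (h : μ ≤ ν) : μ.card ≤ ν.card :=
  Finset.card_le_card (YoungDiagram.cells_subset_iff.2 h)

theorem eq_of_le_card {μ ν : YoungDiagram} (h : μ ≤ ν) (hc : ν.card ≤ μ.card) : μ = ν :=
  YoungDiagram.ext (Finset.eq_of_subset_of_card_le (YoungDiagram.cells_subset_iff.2 h) hc)

theorem card_sup_inf (μ ν : YoungDiagram) :
    (μ ⊔ ν).card + (μ ⊓ ν).card = μ.card + ν.card := by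
  unfold YoungDiagram.card
  rw [YoungDiagram.cells_sup, YoungDiagram.cells_inf]
  exact Finset.card_union_add_card_inter _ _

open scoped Classical in
theorem card_ups_inter {μ ν : YoungDiagram} (hc : μ.card = ν.card) (hne : μ ≠ ν) :
    (ups μ ∩ ups ν).card = (downs μ ∩ downs ν).card := by
  have hlt : μ.card < (μ ⊔ ν).card := by
    by_contra hh
    have e1 := eq_of_le_card (le_sup_left : μ ≤ μ ⊔ ν) (by omega)
    have e2 := eq_of_le_card (le_sup_right : ν ≤ μ ⊔ ν) (by omega)
    exact hne (e1.trans e2.symm)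
  have hs := card_sup_inf μ ν
  by_cases h : (μ ⊔ ν).card = μ.card + 1
  · have e1 : ups μ ∩ ups ν = {μ ⊔ ν} := by
      ext l
      rw [Finset.mem_inter, mem_ups, mem_ups, Finset.mem_singleton]
      constructor
      · rintro ⟨⟨a, b⟩, c, d⟩
        exact (eq_of_le_card (sup_le a c) (by omega)).symm
      · rintro rfl
        exact ⟨⟨le_sup_left, h⟩, le_sup_right, by omega⟩
    have e2 : downs μ ∩ downs ν = {μ ⊓ ν} := by
      ext l
      rw [Finset.mem_inter, mem_downs, mem_downs, Finset.mem_singleton]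
      constructor
      · rintro ⟨⟨a, b⟩, c, d⟩
        exact eq_of_le_card (le_inf a c) (by omega)
      · rintro rfl
        exact ⟨⟨inf_le_left, by omega⟩, inf_le_right, by omega⟩
    rw [e1, e2, Finset.card_singleton, Finset.card_singleton]
  · have e1 : ups μ ∩ ups ν = ∅ := by
      rw [Finset.eq_empty_iff_forall_notMem]
      intro l
      rw [Finset.mem_inter, mem_ups, mem_ups]
      rintro ⟨⟨a, b⟩, c, d⟩
      have := card_le_of_le (sup_le a c)
      omega
    have e2 : downs μ ∩ downs ν = ∅ := by
      rw [Finset.eq_empty_iff_forall_notMem]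
      intro l
      rw [Finset.mem_inter, mem_downs, mem_downs]
      rintro ⟨⟨a, b⟩, c, d⟩
      have := card_le_of_le (le_inf a c)
      omega
    rw [e1, e2]

/-- Add a cell at the end of row `i`. -/
def addRow (ν : YoungDiagram) (i : ℕ) (h : i = 0 ∨ ν.rowLen i < ν.rowLen (i - 1)) :
    YoungDiagram where
  cells := insert (i, ν.rowLen i) ν.cells
  isLowerSet := by
    rintro ⟨a, b⟩ ⟨c, d⟩ hle hm
    simp only [Finset.coe_insert, Set.mem_insert_iff, Finset.mem_coe, Prod.mk.injEq,
      YoungDiagram.mem_cells] at hm ⊢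
    obtain ⟨h1, h2⟩ := Prod.mk_le_mk.1 hle
    rcases hm with ⟨rfl, rfl⟩ | hm
    · by_cases hca : c = a
      · subst hca
        rcases h2.lt_or_eq with h3 | h3
        · right; exact YoungDiagram.mem_iff_lt_rowLen.2 h3
        · left; exact ⟨rfl, h3⟩
      · right
        rw [YoungDiagram.mem_iff_lt_rowLen]
        have := ν.rowLen_anti c (a - 1) (by omega)
        omega
    · right; exact ν.up_left_mem h1 h2 hm

/-- Remove the last cell of row `i`. -/
def remRow (ν : YoungDiagram) (i : ℕ) (h : ν.rowLen (i + 1) < ν.rowLen i) :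
    YoungDiagram where
  cells := ν.cells.erase (i, ν.rowLen i - 1)
  isLowerSet := by
    rintro ⟨a, b⟩ ⟨c, d⟩ hle hm
    simp only [Finset.coe_erase, Set.mem_sdiff, Finset.mem_coe, Set.mem_singleton_iff,
      Prod.mk.injEq, YoungDiagram.mem_cells] at hm ⊢
    obtain ⟨h1, h2⟩ := Prod.mk_le_mk.1 hle
    refine ⟨ν.up_left_mem h1 h2 hm.1, ?_⟩
    rintro ⟨rfl, rfl⟩
    apply hm.2
    have h3 := YoungDiagram.mem_iff_lt_rowLen.1 hm.1
    have h4 : a = c := by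
      by_contra hne
      have := ν.rowLen_anti (c + 1) a (by omega)
      omega
    subst h4
    exact ⟨rfl, by omega⟩

/-- Removable rows. -/
def remRows (ν : YoungDiagram) : Finset ℕ :=
  (Finset.range (ν.colLen 0)).filter fun i => ν.rowLen (i + 1) < ν.rowLen i

theorem mem_remRows {ν : YoungDiagram} {i : ℕ} :
    i ∈ remRows ν ↔ ν.rowLen (i + 1) < ν.rowLen i := by
  simp only [remRows, Finset.mem_filter, Finset.mem_range, and_iff_right_iff_imp]
  intro h
  exact YoungDiagram.mem_iff_lt_colLen.1 (YoungDiagram.mem_iff_lt_rowLen.2 (by omega))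

theorem exists_cell {κ μ : YoungDiagram} (h : κ ≤ μ) (hc : μ.card = κ.card + 1) :
    ∃ i j, (i, j) ∉ κ.cells ∧ μ.cells = insert (i, j) κ.cells := by
  have hs := YoungDiagram.cells_subset_iff.2 h
  have : (μ.cells \ κ.cells).card = 1 := by
    have := Finset.card_sdiff_add_card_eq_card hs
    unfold YoungDiagram.card at hc
    omega
  obtain ⟨⟨i, j⟩, hij⟩ := Finset.card_eq_one.1 this
  have hm : (i, j) ∈ μ.cells \ κ.cells := by rw [hij]; simp
  rw [Finset.mem_sdiff] at hm
  refine ⟨i, j, hm.2, ?_⟩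
  rw [← Finset.sdiff_union_of_subset hs, hij]
  rfl

theorem card_downs (ν : YoungDiagram) : (downs ν).card = (remRows ν).card := by
  symm
  refine Finset.card_bij (fun i hi => remRow ν i (mem_remRows.1 hi)) ?_ ?_ ?_
  · intro i hi
    have hi := mem_remRows.1 hi
    have hm : (i, ν.rowLen i - 1) ∈ ν.cells :=
      YoungDiagram.mem_iff_lt_rowLen.2 (by omega)
    rw [mem_downs]
    refine ⟨YoungDiagram.cells_subset_iff.1 (Finset.erase_subset _ _), ?_⟩
    exact Finset.card_erase_add_one hm
  · intro a ha b hb hab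
    have hi := mem_remRows.1 ha
    have hm : (a, ν.rowLen a - 1) ∈ ν.cells :=
      YoungDiagram.mem_iff_lt_rowLen.2 (by omega)
    have h2 : ν.cells.erase (a, ν.rowLen a - 1) = ν.cells.erase (b, ν.rowLen b - 1) :=
      congrArg YoungDiagram.cells hab
    by_contra hne
    have h3 : (a, ν.rowLen a - 1) ∈ ν.cells.erase (b, ν.rowLen b - 1) :=
      Finset.mem_erase.2 ⟨fun h => hne (Prod.mk.inj h).1, hm⟩
    rw [← h2] at h3
    simp at h3
  · intro κ hκ
    rw [mem_downs] at hκ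
    obtain ⟨i, j, h1, h2⟩ := exists_cell hκ.1 hκ.2.symm
    have hm : (i, j) ∈ ν := by
      rw [← YoungDiagram.mem_cells, h2]; exact Finset.mem_insert_self _ _
    have key : ∀ a b, (a, b) ∈ ν → i ≤ a → j ≤ b → a = i ∧ b = j := by
      intro a b hab hia hjb
      rw [← YoungDiagram.mem_cells, h2, Finset.mem_insert] at hab
      rcases hab with hab | hab
      · exact Prod.mk.inj hab
      · exact absurd (κ.up_left_mem hia hjb hab) h1
    have hj := YoungDiagram.mem_iff_lt_rowLen.1 hm
    have hj2 : ν.rowLen i ≤ j + 1 := by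
      by_contra hh
      have := key i (j + 1) (YoungDiagram.mem_iff_lt_rowLen.2 (by omega)) le_rfl (by omega)
      omega
    have hi : ν.rowLen (i + 1) < ν.rowLen i := by
      by_contra hh
      have := key (i + 1) j (YoungDiagram.mem_iff_lt_rowLen.2 (by omega)) (by omega) le_rfl
      omega
    refine ⟨i, mem_remRows.2 hi, ?_⟩
    apply YoungDiagram.ext
    change ν.cells.erase (i, ν.rowLen i - 1) = κ.cells
    have : ν.rowLen i - 1 = j := by omega
    rw [this, h2, Finset.erase_insert h1]

theorem card_ups (ν : YoungDiagram) : (ups ν).card = (remRows ν).card + 1 := by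
  have hcard : (insert 0 ((remRows ν).image Nat.succ)).card = (remRows ν).card + 1 := by
    rw [Finset.card_insert_of_notMem (by simp),
      Finset.card_image_of_injective _ Nat.succ_injective]
  have hmem : ∀ i, i ∈ insert 0 ((remRows ν).image Nat.succ) ↔
      i = 0 ∨ ν.rowLen i < ν.rowLen (i - 1) := by
    intro i
    rw [Finset.mem_insert, Finset.mem_image]
    constructor
    · rintro (h | ⟨a, ha, rfl⟩)
      · exact Or.inl h
      · right; exact mem_remRows.1 ha
    · rintro (h | h)
      · exact Or.inl h
      · by_cases h0 : i = 0
        · exact Or.inl h0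
        · right
          obtain ⟨k, rfl⟩ := Nat.exists_eq_succ_of_ne_zero h0
          exact ⟨k, mem_remRows.2 h, rfl⟩
  rw [← hcard]
  symm
  have hnm : ∀ i, (i, ν.rowLen i) ∉ ν.cells := fun i hi =>
    absurd (YoungDiagram.mem_iff_lt_rowLen.1 hi) (lt_irrefl _)
  refine Finset.card_bij (fun i hi => addRow ν i ((hmem i).1 hi)) ?_ ?_ ?_
  · intro i hi
    rw [mem_ups]
    refine ⟨YoungDiagram.cells_subset_iff.1 (Finset.subset_insert _ _), ?_⟩
    exact Finset.card_insert_of_notMem (hnm i)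
  · intro a ha b hb hab
    have h2 : insert (a, ν.rowLen a) ν.cells = insert (b, ν.rowLen b) ν.cells :=
      congrArg YoungDiagram.cells hab
    have h3 : (a, ν.rowLen a) ∈ insert (b, ν.rowLen b) ν.cells := by
      rw [← h2]; exact Finset.mem_insert_self _ _
    rcases Finset.mem_insert.1 h3 with h3 | h3
    · exact (Prod.mk.inj h3).1
    · exact absurd h3 (hnm a)
  · intro l hl
    rw [mem_ups] at hl
    obtain ⟨i, j, h1, h2⟩ := exists_cell hl.1 hl.2
    have hm : (i, j) ∈ l := by
      rw [← YoungDiagram.mem_cells, h2]; exact Finset.mem_insert_self _ _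
    have key : ∀ a b, a ≤ i → b ≤ j → (a ≠ i ∨ b ≠ j) → (a, b) ∈ ν := by
      intro a b hia hjb hne
      have hab : (a, b) ∈ l := l.up_left_mem hia hjb hm
      rw [← YoungDiagram.mem_cells, h2, Finset.mem_insert] at hab
      rcases hab with hab | hab
      · obtain ⟨rfl, rfl⟩ := Prod.mk.inj hab
        simp at hne
      · exact hab
    have hj : ν.rowLen i ≤ j := by
      by_contra hh
      exact h1 (YoungDiagram.mem_iff_lt_rowLen.2 (by omega))
    have hj2 : j ≤ ν.rowLen i := by
      by_contra hh
      have := YoungDiagram.mem_iff_lt_rowLen.1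
        (key i (ν.rowLen i) le_rfl (by omega) (by omega))
      omega
    have hi : i = 0 ∨ ν.rowLen i < ν.rowLen (i - 1) := by
      by_cases h0 : i = 0
      · exact Or.inl h0
      · right
        have := YoungDiagram.mem_iff_lt_rowLen.1 (key (i - 1) j (by omega) le_rfl (by omega))
        omega
    refine ⟨i, (hmem i).2 hi, ?_⟩
    apply YoungDiagram.ext
    change insert (i, ν.rowLen i) ν.cells = l.cells
    have : ν.rowLen i = j := by omega
    rw [this, h2]

open scoped Classical in
theorem du_ud (φ : YoungDiagram → ℕ) (μ : YoungDiagram) :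
    ∑ l ∈ ups μ, ∑ ν ∈ downs l, φ ν = ∑ k ∈ downs μ, ∑ ν ∈ ups k, φ ν + φ μ := by
  have e1 : ∑ l ∈ ups μ, ∑ ν ∈ downs l, φ ν = ∑ ν ∈ Y μ.card, ∑ _l ∈ ups μ ∩ ups ν, φ ν := by
    apply Finset.sum_comm'
    intro l ν
    rw [Finset.mem_inter, mem_ups, mem_ups, mem_downs, mem_Y]
    constructor
    · rintro ⟨⟨a, b⟩, c, d⟩; exact ⟨⟨⟨a, b⟩, c, by omega⟩, by omega⟩
    · rintro ⟨⟨⟨a, b⟩, c, d⟩, e⟩; exact ⟨⟨a, b⟩, c, by omega⟩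
  have e2 : ∑ l ∈ downs μ, ∑ ν ∈ ups l, φ ν =
      ∑ ν ∈ Y μ.card, ∑ _l ∈ downs μ ∩ downs ν, φ ν := by
    apply Finset.sum_comm'
    intro l ν
    rw [Finset.mem_inter, mem_ups, mem_downs, mem_downs, mem_Y]
    constructor
    · rintro ⟨⟨a, b⟩, c, d⟩; exact ⟨⟨⟨a, b⟩, c, by omega⟩, by omega⟩
    · rintro ⟨⟨⟨a, b⟩, c, d⟩, e⟩; exact ⟨⟨a, b⟩, c, by omega⟩
  have hμ : μ ∈ Y μ.card := mem_Y.2 rfl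
  rw [e1, e2, ← Finset.add_sum_erase _ _ hμ, ← Finset.add_sum_erase _ _ hμ]
  have e3 : ∑ ν ∈ (Y μ.card).erase μ, ∑ _l ∈ ups μ ∩ ups ν, φ ν =
      ∑ ν ∈ (Y μ.card).erase μ, ∑ _l ∈ downs μ ∩ downs ν, φ ν := by
    apply Finset.sum_congr rfl
    intro ν hν
    rw [Finset.mem_erase, mem_Y] at hν
    rw [Finset.sum_const, Finset.sum_const, card_ups_inter hν.2.symm hν.1.symm]
  rw [e3, Finset.inter_self, Finset.inter_self, Finset.sum_const, Finset.sum_const, card_ups,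
    card_downs]
  simp only [smul_eq_mul]
  ring

end EGProof
namespace EGProof

/-- The number of involutions of `Fin n`. -/
noncomputable def invs (n : ℕ) : ℕ := Nat.card {σ : Equiv.Perm (Fin n) // σ * σ = 1}

theorem invs_congr {α : Type} [Fintype α] {n : ℕ} (h : Fintype.card α = n) :
    Nat.card {σ : Equiv.Perm α // σ * σ = 1} = invs n := by
  let e : α ≃ Fin n := Fintype.equivFinOfCardEq h
  refine Nat.card_congr (Equiv.subtypeEquiv e.permCongrHom.toEquiv ?_)
  intro σ
  change σ * σ = 1 ↔ e.permCongrHom σ * e.permCongrHom σ = 1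
  rw [← map_mul, map_eq_one_iff _ e.permCongrHom.injective]

theorem invs_sub {α : Type} [Fintype α] [DecidableEq α] (p : α → Prop) [DecidablePred p]
    {n : ℕ} (h : Fintype.card {a // p a} = n) :
    Nat.card {σ : Equiv.Perm α // σ * σ = 1 ∧ ∀ a, ¬ p a → σ a = a} = invs n := by
  rw [← invs_congr h]
  symm
  let g : {τ : Equiv.Perm {a // p a} // τ * τ = 1} →
      {σ : Equiv.Perm α // σ * σ = 1 ∧ ∀ a, ¬ p a → σ a = a} := fun τ =>
    ⟨Equiv.Perm.ofSubtype τ.1, by rw [← map_mul, τ.2, map_one],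
      fun a ha => Equiv.Perm.ofSubtype_apply_of_not_mem _ ha⟩
  refine Nat.card_congr (Equiv.ofBijective g ⟨?_, ?_⟩)
  · intro a b hab
    exact Subtype.ext (Equiv.Perm.ofSubtype_injective (Subtype.mk.inj hab))
  · rintro ⟨σ, h1, h2⟩
    have e := (Equiv.Perm.subtypeEquivSubtypePerm p).apply_symm_apply ⟨σ, h2⟩
    have e2 : Equiv.Perm.ofSubtype ((Equiv.Perm.subtypeEquivSubtypePerm p).symm ⟨σ, h2⟩) = σ :=
      congrArg Subtype.val e
    refine ⟨⟨(Equiv.Perm.subtypeEquivSubtypePerm p).symm ⟨σ, h2⟩, ?_⟩, ?_⟩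
    · apply Equiv.Perm.ofSubtype_injective
      rw [map_mul, e2, h1, map_one]
    · exact Subtype.ext e2

theorem invs_swap {α : Type} [DecidableEq α] (x y : α) :
    Nat.card {σ : Equiv.Perm α // σ * σ = 1 ∧ σ x = y} =
    Nat.card {σ : Equiv.Perm α // σ * σ = 1 ∧ ∀ a, ¬ (a ≠ x ∧ a ≠ y) → σ a = a} := by
  have inv2 : ∀ σ : Equiv.Perm α, σ * σ = 1 → ∀ a, σ (σ a) = a := by
    intro σ h a
    have := congrArg (fun τ : Equiv.Perm α => τ a) h
    simpa using this
  refine Nat.card_congr (Equiv.subtypeEquiv (Equiv.mulLeft (Equiv.swap x y)) ?_)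
  intro σ
  change _ ↔ (Equiv.swap x y * σ) * (Equiv.swap x y * σ) = 1 ∧
    ∀ a, ¬ (a ≠ x ∧ a ≠ y) → (Equiv.swap x y * σ) a = a
  constructor
  · rintro ⟨h1, h2⟩
    have i2 := inv2 σ h1
    have h3 : σ y = x := by rw [← h2, i2]
    have hc : Equiv.swap x y * σ = σ * Equiv.swap x y := by
      have := Equiv.mul_swap_eq_swap_mul σ x y
      rw [h2, h3, Equiv.swap_comm y x] at this
      exact this.symm
    constructor
    · rw [mul_assoc, ← mul_assoc σ, ← hc, mul_assoc, h1, mul_one, Equiv.swap_mul_self]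
    · intro a ha
      have : a = x ∨ a = y := by tauto
      rw [Equiv.Perm.mul_apply]
      rcases this with rfl | rfl
      · rw [h2, Equiv.swap_apply_right]
      · rw [h3, Equiv.swap_apply_left]
  · rintro ⟨h1, h2⟩
    set τ := Equiv.swap x y * σ with hτ
    have hs : σ = Equiv.swap x y * τ := by
      rw [hτ, ← mul_assoc, Equiv.swap_mul_self, one_mul]
    have hx : τ x = x := h2 x (by simp)
    have hy : τ y = y := h2 y (by simp)
    have hc : Equiv.swap x y * τ = τ * Equiv.swap x y := by
      have := Equiv.mul_swap_eq_swap_mul τ x y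
      rw [hx, hy] at this
      exact this.symm
    rw [hs]
    constructor
    · rw [mul_assoc, ← mul_assoc τ, ← hc, mul_assoc, h1, mul_one, Equiv.swap_mul_self]
    · rw [Equiv.Perm.mul_apply, hx, Equiv.swap_apply_left]

theorem invs_rec (n : ℕ) : invs (n + 2) = invs (n + 1) + (n + 1) * invs n := by
  have e1 : invs (n + 2) =
      ∑ y : Fin (n + 2), Nat.card {σ : Equiv.Perm (Fin (n + 2)) // σ * σ = 1 ∧ σ 0 = y} := by
    rw [← Nat.card_sigma]
    symm
    refine Nat.card_congr ⟨fun p => ⟨p.2.1, p.2.2.1⟩, fun σ => ⟨σ.1 0, ⟨σ.1, σ.2, rfl⟩⟩, ?_, ?_⟩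
    · rintro ⟨y, σ, h1, rfl⟩; rfl
    · intro σ; rfl
  rw [e1, Fin.sum_univ_succ, invs_swap,
    invs_sub (fun a : Fin (n + 2) => a ≠ 0 ∧ a ≠ 0) (n := n + 1)]
  · congr 1
    rw [Finset.sum_eq_card_nsmul (b := invs n)]
    · simp
    · intro y _
      rw [invs_swap, invs_sub (fun a : Fin (n + 2) => a ≠ 0 ∧ a ≠ y.succ)]
      rw [Fintype.card_subtype]
      have : (Finset.univ.filter fun a : Fin (n + 2) => a ≠ 0 ∧ a ≠ y.succ) =
          (Finset.univ.erase 0).erase y.succ := by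
        ext a; simp [and_comm]
      rw [this, Finset.card_erase_of_mem (by simp), Finset.card_erase_of_mem (by simp)]
      simp
  · rw [Fintype.card_subtype]
    have : (Finset.univ.filter fun a : Fin (n + 2) => a ≠ 0 ∧ a ≠ 0) =
        Finset.univ.erase 0 := by
      ext a; simp
    rw [this, Finset.card_erase_of_mem (by simp)]
    simp

theorem invs_zero : invs 0 = 1 := by
  unfold invs
  rw [Nat.card_eq_one_iff_unique]
  exact ⟨⟨fun a b => Subtype.ext (Subsingleton.elim _ _)⟩, ⟨⟨1, one_mul 1⟩⟩⟩

theorem invs_one : invs 1 = 1 := by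
  unfold invs
  rw [Nat.card_eq_one_iff_unique]
  exact ⟨⟨fun a b => Subtype.ext (Subsingleton.elim _ _)⟩, ⟨⟨1, one_mul 1⟩⟩⟩

theorem invs_pos (n : ℕ) : 0 < invs n := by
  unfold invs
  rw [Nat.card_pos_iff]
  exact ⟨⟨⟨1, one_mul 1⟩⟩, inferInstance⟩

end EGProof
namespace EGProof

theorem syt_finite (μ : YoungDiagram) : Finite (SYTset μ) := by
  let g : SYTset μ → (μ.cells → Fin (μ.card + 1)) := fun U c =>
    ⟨U.1 c.1.1 c.1.2, Nat.lt_succ_of_le (syt_bounds U.2 c.2).2⟩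
  apply Finite.of_injective g
  rintro ⟨U, hU⟩ ⟨V, hV⟩ h
  apply Subtype.ext
  funext i j
  by_cases hm : (i, j) ∈ μ.cells
  · exact congrArg Fin.val (congrFun h ⟨(i, j), hm⟩)
  · exact (hU.2.2.1 i j hm).trans (hV.2.2.1 i j hm).symm

/-- The number of standard tableaux. -/
noncomputable def nf (μ : YoungDiagram) : ℕ := Nat.card (SYTset μ)

/-- Extend a tableau on `ν` to `μ` with the largest label. -/
def ext1 (ν μ : YoungDiagram) (V : ℕ → ℕ → ℕ) (i j : ℕ) : ℕ :=
  if (i, j) ∈ ν.cells then V i j else if (i, j) ∈ μ.cells then μ.card else 0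

theorem ext1_mem {ν μ : YoungDiagram} (h : ν ∈ downs μ) {V : ℕ → ℕ → ℕ}
    (hV : V ∈ SYTset ν) : ext1 ν μ V ∈ SYTset μ := by
  rw [mem_downs] at h
  have hsub := YoungDiagram.cells_subset_iff.2 h.1
  obtain ⟨a, b, hab, hins⟩ := exists_cell h.1 h.2.symm
  have hone : ∀ i j, (i, j) ∈ μ.cells → (i, j) ∉ ν.cells → i = a ∧ j = b := by
    intro i j h1 h2
    rw [hins, Finset.mem_insert] at h1
    rcases h1 with h1 | h1
    · exact Prod.mk.inj h1
    · exact absurd h1 h2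
  refine ⟨?_, ?_, ?_, ?_⟩
  · intro i j1 j2 hj hm
    have hm1 : (i, j1) ∈ μ.cells := μ.up_left_mem le_rfl hj.le hm
    unfold ext1
    by_cases h2 : (i, j2) ∈ ν.cells
    · have h1 : (i, j1) ∈ ν.cells := ν.up_left_mem le_rfl hj.le h2
      rw [if_pos h1, if_pos h2]
      exact hV.1 i j1 j2 hj h2
    · have h1 : (i, j1) ∈ ν.cells := by
        by_contra h1
        have := hone _ _ hm1 h1
        have := hone _ _ hm h2
        omega
      rw [if_pos h1, if_neg h2, if_pos hm]
      have := syt_bounds hV h1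
      omega
  · intro i1 i2 j hi hm
    have hm1 : (i1, j) ∈ μ.cells := μ.up_left_mem hi.le le_rfl hm
    unfold ext1
    by_cases h2 : (i2, j) ∈ ν.cells
    · have h1 : (i1, j) ∈ ν.cells := ν.up_left_mem hi.le le_rfl h2
      rw [if_pos h1, if_pos h2]
      exact hV.2.1 i1 i2 j hi h2
    · have h1 : (i1, j) ∈ ν.cells := by
        by_contra h1
        have := hone _ _ hm1 h1
        have := hone _ _ hm h2
        omega
      rw [if_pos h1, if_neg h2, if_pos hm]
      have := syt_bounds hV h1
      omega
  · intro i j hm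
    unfold ext1
    rw [if_neg (fun hh => hm (hsub hh)), if_neg hm]
  · rw [hins, Finset.image_insert]
    have e1 : ν.cells.image (fun c => ext1 ν μ V c.1 c.2) =
        ν.cells.image (fun c => V c.1 c.2) := by
      apply Finset.image_congr
      intro c hc
      exact if_pos hc
    have e2 : ext1 ν μ V a b = μ.card := by
      unfold ext1
      rw [if_neg hab, if_pos (by rw [hins]; exact Finset.mem_insert_self _ _)]
    rw [e1, hV.2.2.2]
    change insert (ext1 ν μ V a b) _ = _
    rw [e2, ← h.2]
    ext k
    simp only [Finset.mem_insert, Finset.mem_Icc]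
    omega

theorem ext1_shape {ν μ : YoungDiagram} (h : ν ∈ downs μ) {V : ℕ → ℕ → ℕ}
    (hV : V ∈ SYTset ν) :
    ν.cells = μ.cells.filter fun c => ext1 ν μ V c.1 c.2 < μ.card := by
  rw [mem_downs] at h
  have hsub := YoungDiagram.cells_subset_iff.2 h.1
  ext ⟨i, j⟩
  rw [Finset.mem_filter]
  unfold ext1
  constructor
  · intro hm
    refine ⟨hsub hm, ?_⟩
    rw [if_pos hm]
    have := syt_bounds hV hm
    change V i j < μ.card
    omega
  · rintro ⟨hm, hlt⟩
    by_contra hn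
    rw [if_neg hn, if_pos hm] at hlt
    omega

/-- Remove the largest label. -/
def cut1 (μ : YoungDiagram) (U : ℕ → ℕ → ℕ) (hU : U ∈ SYTset μ) : YoungDiagram where
  cells := μ.cells.filter fun c => U c.1 c.2 < μ.card
  isLowerSet := by
    rintro ⟨a, b⟩ ⟨c, d⟩ hle hm
    simp only [Finset.mem_coe, Finset.mem_filter] at hm ⊢
    obtain ⟨h1, h2⟩ := Prod.mk_le_mk.1 hle
    refine ⟨μ.up_left_mem h1 h2 hm.1, ?_⟩
    have hm2 : (c, b) ∈ μ.cells := μ.up_left_mem h1 le_rfl hm.1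
    have e1 : U c b ≤ U a b := by
      rcases h1.lt_or_eq with h1 | h1
      · exact (hU.2.1 _ _ _ h1 hm.1).le
      · exact le_of_eq (congrArg (fun z => U z b) h1)
    have e2 : U c d ≤ U c b := by
      rcases h2.lt_or_eq with h2 | h2
      · exact (hU.1 _ _ _ h2 hm2).le
      · exact le_of_eq (congrArg (fun z => U c z) h2)
    have := hm.2
    omega

theorem cut1_down {μ : YoungDiagram} {U : ℕ → ℕ → ℕ} (hU : U ∈ SYTset μ) (hpos : 0 < μ.card) :
    cut1 μ U hU ∈ downs μ := by
  rw [mem_downs]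
  refine ⟨YoungDiagram.cells_subset_iff.1 (Finset.filter_subset _ _), ?_⟩
  have : μ.card ∈ μ.cells.image (fun c => U c.1 c.2) := by
    rw [hU.2.2.2, Finset.mem_Icc]; omega
  obtain ⟨c, hc, h⟩ := Finset.mem_image.1 this
  have h : U c.1 c.2 = μ.card := h
  have e : (cut1 μ U hU).cells = μ.cells.erase c := by
    ext d
    change d ∈ μ.cells.filter _ ↔ _
    rw [Finset.mem_filter, Finset.mem_erase]
    constructor
    · rintro ⟨h1, h2⟩
      refine ⟨?_, h1⟩
      rintro rfl
      omega
    · rintro ⟨h1, h2⟩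
      refine ⟨h2, ?_⟩
      have hb := syt_bounds hU h2
      rcases hb.2.lt_or_eq with h3 | h3
      · exact h3
      · exact absurd (syt_injOn hU h2 hc (h3.trans h.symm)) h1
  unfold YoungDiagram.card
  rw [e]
  exact Finset.card_erase_add_one hc

theorem cut1_syt {μ : YoungDiagram} {U : ℕ → ℕ → ℕ} (hU : U ∈ SYTset μ) (hpos : 0 < μ.card) :
    (fun i j => if (i, j) ∈ (cut1 μ U hU).cells then U i j else 0) ∈ SYTset (cut1 μ U hU) := by
  have hd := mem_downs.1 (cut1_down hU hpos)
  have hsub := YoungDiagram.cells_subset_iff.2 hd.1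
  have hmem : ∀ i j, (i, j) ∈ (cut1 μ U hU).cells ↔ (i, j) ∈ μ.cells ∧ U i j < μ.card := by
    intro i j
    exact Finset.mem_filter
  refine ⟨?_, ?_, ?_, ?_⟩
  · intro i j1 j2 hj hm
    have hm1 : (i, j1) ∈ (cut1 μ U hU).cells := YoungDiagram.up_left_mem _ le_rfl hj.le hm
    simp only [if_pos hm1, if_pos hm]
    exact hU.1 _ _ _ hj (hsub hm)
  · intro i1 i2 j hi hm
    have hm1 : (i1, j) ∈ (cut1 μ U hU).cells := YoungDiagram.up_left_mem _ hi.le le_rfl hm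
    simp only [if_pos hm1, if_pos hm]
    exact hU.2.1 _ _ _ hi (hsub hm)
  · intro i j hm
    exact if_neg hm
  · ext k
    rw [Finset.mem_image, Finset.mem_Icc]
    constructor
    · rintro ⟨c, hc, rfl⟩
      have h1 := (hmem c.1 c.2).1 hc
      have hb := syt_bounds hU h1.1
      simp only [if_pos hc]
      omega
    · rintro ⟨h1, h2⟩
      have : k ∈ μ.cells.image (fun c => U c.1 c.2) := by
        rw [hU.2.2.2, Finset.mem_Icc]; omega
      obtain ⟨c, hc, h⟩ := Finset.mem_image.1 this
      have h : U c.1 c.2 = k := h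
      have hc2 : c ∈ (cut1 μ U hU).cells := (hmem c.1 c.2).2 ⟨hc, by omega⟩
      exact ⟨c, hc2, (if_pos hc2).trans h⟩

theorem ext1_cut1 {μ : YoungDiagram} {U : ℕ → ℕ → ℕ} (hU : U ∈ SYTset μ) :
    ext1 (cut1 μ U hU) μ (fun i j => if (i, j) ∈ (cut1 μ U hU).cells then U i j else 0) = U := by
  funext i j
  unfold ext1
  by_cases h1 : (i, j) ∈ (cut1 μ U hU).cells
  · simp only [if_pos h1]
  · rw [if_neg h1]
    by_cases h2 : (i, j) ∈ μ.cells
    · rw [if_pos h2]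
      have hb := syt_bounds hU h2
      by_contra hne
      exact h1 (Finset.mem_filter.2 ⟨h2, by
        change U i j < μ.card
        omega⟩)
    · rw [if_neg h2, hU.2.2.1 i j h2]

theorem nf_rec (μ : YoungDiagram) (hpos : 0 < μ.card) : nf μ = ∑ ν ∈ downs μ, nf ν := by
  have : ∀ ν : YoungDiagram, Finite (SYTset ν) := syt_finite
  unfold nf
  rw [← Finset.sum_coe_sort (downs μ) (fun ν => Nat.card (SYTset ν)), ← Nat.card_sigma]
  symm
  let g : (Σ ν : downs μ, SYTset ν.1) → SYTset μ := fun p =>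
    ⟨ext1 p.1.1 μ p.2.1, ext1_mem p.1.2 p.2.2⟩
  refine Nat.card_congr (Equiv.ofBijective g ⟨?_, ?_⟩)
  · rintro ⟨⟨ν, hν⟩, V, hV⟩ ⟨⟨ν', hν'⟩, V', hV'⟩ h
    have h : ext1 ν μ V = ext1 ν' μ V' := Subtype.mk.inj h
    have hs : ν = ν' := by
      apply YoungDiagram.ext
      rw [ext1_shape hν hV, ext1_shape hν' hV', h]
    subst hs
    have hVV : V = V' := by
      funext i j
      by_cases hm : (i, j) ∈ ν.cells
      · have := congrFun (congrFun h i) j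
        unfold ext1 at this
        rwa [if_pos hm, if_pos hm] at this
      · exact (hV.2.2.1 i j hm).trans (hV'.2.2.1 i j hm).symm
    subst hVV
    rfl
  · rintro ⟨U, hU⟩
    exact ⟨⟨⟨cut1 μ U hU, cut1_down hU hpos⟩, ⟨_, cut1_syt hU hpos⟩⟩,
      Subtype.ext (ext1_cut1 hU)⟩

theorem card_zero_iff {μ : YoungDiagram} : μ.card = 0 ↔ μ = ⊥ := by
  constructor
  · intro h
    apply YoungDiagram.ext
    rw [YoungDiagram.cells_bot]
    exact Finset.card_eq_zero.1 h
  · rintro rfl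
    simp

theorem nf_bot : nf ⊥ = 1 := by
  unfold nf
  rw [Nat.card_eq_one_iff_unique]
  refine ⟨⟨?_⟩, ⟨⟨fun _ _ => 0, ?_⟩⟩⟩
  · rintro ⟨a, ha⟩ ⟨b, hb⟩
    apply Subtype.ext
    funext i j
    exact (ha.2.2.1 i j (by simp)).trans (hb.2.2.1 i j (by simp)).symm
  · refine ⟨?_, ?_, ?_, ?_⟩ <;> simp

theorem nf_up (n : ℕ) : ∀ μ : YoungDiagram, μ.card = n →
    ∑ l ∈ ups μ, nf l = (n + 1) * nf μ := by
  induction n with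
  | zero =>
    intro μ hμ
    have e : ∑ l ∈ ups μ, nf l = ∑ l ∈ ups μ, ∑ ν ∈ downs l, nf ν :=
      Finset.sum_congr rfl fun l hl => nf_rec l (by have := (mem_ups.1 hl).2; omega)
    have hd : downs μ = ∅ := by
      rw [Finset.eq_empty_iff_forall_notMem]
      intro k hk
      have := (mem_downs.1 hk).2
      omega
    rw [e, du_ud, hd]
    simp
  | succ n ih =>
    intro μ hμ
    have e : ∑ l ∈ ups μ, nf l = ∑ l ∈ ups μ, ∑ ν ∈ downs l, nf ν :=
      Finset.sum_congr rfl fun l hl => nf_rec l (by have := (mem_ups.1 hl).2; omega)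
    have e2 : ∑ k ∈ downs μ, ∑ ν ∈ ups k, nf ν = ∑ k ∈ downs μ, (n + 1) * nf k :=
      Finset.sum_congr rfl fun k hk => ih k (by have := (mem_downs.1 hk).2; omega)
    rw [e, du_ud, e2, ← Finset.mul_sum, ← nf_rec μ (by omega)]
    ring

/-- Total number of standard tableaux of size `n`. -/
noncomputable def tt (n : ℕ) : ℕ := ∑ μ ∈ Y n, nf μ

theorem tt_step (n : ℕ) :
    tt (n + 1) = tt n + ∑ ν ∈ Y n, (downs ν).card * nf ν := by
  have e1 : tt (n + 1) = ∑ l ∈ Y (n + 1), ∑ ν ∈ downs l, nf ν :=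
    Finset.sum_congr rfl fun l hl => nf_rec l (by have := mem_Y.1 hl; omega)
  have e2 : ∑ l ∈ Y (n + 1), ∑ ν ∈ downs l, nf ν = ∑ ν ∈ Y n, ∑ _l ∈ ups ν, nf ν := by
    apply Finset.sum_comm'
    intro l ν
    rw [mem_ups, mem_downs, mem_Y, mem_Y]
    constructor
    · rintro ⟨a, b, c⟩; exact ⟨⟨b, by omega⟩, by omega⟩
    · rintro ⟨⟨a, b⟩, c⟩; exact ⟨by omega, a, by omega⟩
  rw [e1, e2, tt, ← Finset.sum_add_distrib]
  apply Finset.sum_congr rfl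
  intro ν _
  rw [Finset.sum_const, card_ups, card_downs, smul_eq_mul]
  ring

theorem tt_rec (n : ℕ) : tt (n + 2) = tt (n + 1) + (n + 1) * tt n := by
  rw [tt_step (n + 1)]
  congr 1
  have e2 : ∑ ν ∈ Y (n + 1), ∑ _k ∈ downs ν, nf ν = ∑ k ∈ Y n, ∑ ν ∈ ups k, nf ν := by
    apply Finset.sum_comm'
    intro l ν
    rw [mem_ups, mem_downs, mem_Y, mem_Y]
    constructor
    · rintro ⟨a, b, c⟩; exact ⟨⟨b, by omega⟩, by omega⟩
    · rintro ⟨⟨a, b⟩, c⟩; exact ⟨by omega, a, by omega⟩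
  simp only [Finset.sum_const, smul_eq_mul] at e2
  rw [e2, tt, Finset.mul_sum]
  exact Finset.sum_congr rfl fun k hk => nf_up n k (mem_Y.1 hk)

theorem Y_zero : Y 0 = {⊥} := by
  ext μ
  rw [mem_Y, Finset.mem_singleton, card_zero_iff]

theorem tt_zero : tt 0 = 1 := by
  rw [tt, Y_zero, Finset.sum_singleton, nf_bot]

theorem tt_one : tt 1 = 1 := by
  have hd : downs ⊥ = ∅ := by
    rw [Finset.eq_empty_iff_forall_notMem]
    intro k hk
    have := (mem_downs.1 hk).2
    rw [card_zero_iff.2 rfl] at this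
    omega
  rw [tt_step 0, tt_zero, Y_zero, Finset.sum_singleton, hd]
  simp

theorem tt_eq (n : ℕ) : tt n = invs n ∧ tt (n + 1) = invs (n + 1) := by
  induction n with
  | zero => exact ⟨tt_zero.trans invs_zero.symm, tt_one.trans invs_one.symm⟩
  | succ n ih => exact ⟨ih.2, by rw [tt_rec, invs_rec, ih.1, ih.2]⟩

theorem count_eq (n : ℕ) : Nat.card (SYTn n) = invs n := by
  have : ∀ ν : YoungDiagram, Finite (SYTset ν) := syt_finite
  rw [← (tt_eq n).1, tt]
  unfold nf
  rw [← Finset.sum_coe_sort (Y n) (fun ν => Nat.card (SYTset ν)), ← Nat.card_sigma]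
  refine Nat.card_congr ⟨fun p => ⟨⟨p.1.1, mem_Y.2 p.2.1⟩, ⟨p.1.2, p.2.2⟩⟩,
    fun p => ⟨(p.1.1, p.2.1), mem_Y.1 p.1.2, p.2.2⟩, ?_, ?_⟩
  · intro p; rfl
  · intro p; rfl

end EGProof

/-- The maximum of `EG(w)` over permutations of Coxeter length `n` is the number of
involutions in `S_n`. -/
theorem stmt12 (n : ℕ) :
    IsGreatest
      {m : ℕ | ∃ w : Equiv.Perm ℕ, (∃ l : List ℕ, IsReducedWord w l ∧ l.length = n) ∧
        m = Nat.card
          {p : YoungDiagram × (ℕ → ℕ → ℕ) // p.1.card = n ∧ p.2 ∈ EGset p.1 w}}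
      (Nat.card {σ : Equiv.Perm (Fin n) // σ * σ = 1}) := by
  exact EGProof.reduce_to_count n _ (EGProof.count_eq n) (EGProof.invs_pos n)
end
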